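/- arXiv:2003.13152 — 2 statements merged into one kernel-verified Lean document; each statement's English description precedes it below -/
import Mathlib

section
/- Let a, b, c be positive integers and let k be the cardinality of any orbit of rowmotion Ψ acting on the set J(B_{a,b,c}) of order ideals of the poset B_{a,b,c}. Then gcd(k, a+b+c−1) > 1. -/
/-- An order ideal (downward-closed subset) of a preordered set. -/
def IsOrderIdeal {α : Type*} [Preorder α] (I : Set α) : Prop :=
  ∀ ⦃x y : α⦄, x ≤ y → y ∈ I → x ∈ I

/-- Rowmotion: `Ψ(I)` is the order ideal generated by the minimal elements of
the complement of `I`, i.e. `{x | x ≤ m for some minimal element m ∉ I}`. -/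
def Rowmotion {α : Type*} [Preorder α] (I : Set α) : Set α :=
  {x | ∃ m, m ∉ I ∧ (∀ y, y < m → y ∈ I) ∧ x ≤ m}

structure Growth (a b : ℕ) (q : ℤ) (G : ℤ → ℤ → ℕ → ℕ → Prop) : Prop where
  mono_t : ∀ s t i j, i < a → j < b → G s t i j → G s (t+1) i j
  mono_s : ∀ s t i j, i < a → j < b → G (s+1) t i j → G s t i j
  ti : ∀ s t i j, i + 1 < a → j < b → G s (t+1) (i+1) j → G s t i j
  tj : ∀ s t i j, i < a → j + 1 < b → G s (t+1) i (j+1) → G s t i j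
  si : ∀ s t i j, i + 1 < a → j < b → G s t (i+1) j → G (s+1) t i j
  sj : ∀ s t i j, i < a → j + 1 < b → G s t i (j+1) → G (s+1) t i j
  emp : ∀ s t i j, i < a → j < b → t ≤ s → ¬ G s t i j
  full : ∀ s t i j, i < a → j < b → s + q ≤ t → G s t i j
  tog : ∀ s t i j, i < a → j < b → s < t → t < s + q → G s (t+1) i j → ¬ G (s+1) t i j →
    (∀ i', i' + 1 = i → G (s+1) t i' j) → (∀ j', j' + 1 = j → G (s+1) t i j') →
    (i + 1 < a → ¬ G s (t+1) (i+1) j) → (j + 1 < b → ¬ G s (t+1) i (j+1)) →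
    (G s t i j ↔ ¬ G (s+1) (t+1) i j)

theorem Growth.transpose {a b : ℕ} {q : ℤ} {G : ℤ → ℤ → ℕ → ℕ → Prop} (h : Growth a b q G) :
    Growth b a q (fun s t i j => G s t j i) where
  mono_t s t i j hi hj := h.mono_t s t j i hj hi
  mono_s s t i j hi hj := h.mono_s s t j i hj hi
  ti s t i j hi hj := h.tj s t j i hj hi
  tj s t i j hi hj := h.ti s t j i hj hi
  si s t i j hi hj := h.sj s t j i hj hi
  sj s t i j hi hj := h.si s t j i hj hi
  emp s t i j hi hj := h.emp s t j i hj hi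
  full s t i j hi hj := h.full s t j i hj hi
  tog s t i j hi hj h1 h2 h3 h4 h5 h6 h7 h8 := h.tog s t j i hj hi h1 h2 h3 h4 h6 h5 h8 h7

theorem Growth.dual {a b : ℕ} {q : ℤ} {G : ℤ → ℤ → ℕ → ℕ → Prop} (h : Growth a b q G) :
    Growth a b q (fun s t i j => ¬ G t (s + q) (a - 1 - i) (b - 1 - j)) where
  mono_t s t i j hi hj := fun h1 h2 => h1 (h.mono_s _ _ _ _ (by omega) (by omega) h2)
  mono_s s t i j hi hj := fun h1 h2 => h1 (by
    have := h.mono_t _ _ _ _ (by omega) (by omega) h2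
    rwa [show s + q + 1 = s + 1 + q by ring] at this)
  ti s t i j hi hj := fun h1 h2 => h1 (by
    apply h.si _ _ _ _ (by omega) (by omega)
    rwa [show a - 1 - (i + 1) + 1 = a - 1 - i by omega])
  tj s t i j hi hj := fun h1 h2 => h1 (by
    apply h.sj _ _ _ _ (by omega) (by omega)
    rwa [show b - 1 - (j + 1) + 1 = b - 1 - j by omega])
  si s t i j hi hj := fun h1 h2 => h1 (by
    apply h.ti _ _ _ _ (by omega) (by omega)
    rwa [show a - 1 - (i + 1) + 1 = a - 1 - i by omega, show s + q + 1 = s + 1 + q by ring])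
  sj s t i j hi hj := fun h1 h2 => h1 (by
    apply h.tj _ _ _ _ (by omega) (by omega)
    rwa [show b - 1 - (j + 1) + 1 = b - 1 - j by omega, show s + q + 1 = s + 1 + q by ring])
  emp s t i j hi hj h1 := fun h2 => h2 (h.full _ _ _ _ (by omega) (by omega) (by omega))
  full s t i j hi hj h1 := h.emp _ _ _ _ (by omega) (by omega) (by omega)
  tog s t i j hi hj h1 h2 h3 h4 h5 h6 h7 h8 := by
    rw [show s + 1 + q = s + q + 1 by ring] at *
    have := h.tog t (s + q) (a - 1 - i) (b - 1 - j) (by omega) (by omega) (by omega) (by omega)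
      (not_not.1 h4) h3 ?_ ?_ ?_ ?_
    · tauto
    · intro i' hi'
      have := not_not.1 (h7 (by omega))
      rwa [show a - 1 - (i + 1) = i' by omega] at this
    · intro j' hj'
      have := not_not.1 (h8 (by omega))
      rwa [show b - 1 - (j + 1) = j' by omega] at this
    · intro hh
      have := h5 (i - 1) (by omega)
      rwa [show a - 1 - (i - 1) = a - 1 - i + 1 by omega] at this
    · intro hh
      have := h6 (j - 1) (by omega)
      rwa [show b - 1 - (j - 1) = b - 1 - j + 1 by omega] at this

open Classical in
noncomputable def rc (b : ℕ) (G : ℤ → ℤ → ℕ → ℕ → Prop) (s : ℤ) (i : ℕ) (t : ℤ) : ℤ :=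
  ((Finset.range b).filter (fun j => G s t i j)).card

open Classical in
theorem card_initial (b : ℕ) (P : ℕ → Prop) (h : ∀ j, j + 1 < b → P (j+1) → P j) :
    ∃ n ≤ b, ((Finset.range b).filter P).card = n ∧ ∀ j < b, (P j ↔ j < n) := by
  induction b with
  | zero => exact ⟨0, le_rfl, by simp, by simp⟩
  | succ b ih =>
    obtain ⟨n, hn, hc, hP⟩ := ih (fun j hj => h j (by omega))
    by_cases hb : P b
    · have all : ∀ d ≤ b, P (b - d) := by
        intro d
        induction d with
        | zero => intro _; exact hb
        | succ d ihd =>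
          intro hd
          apply h _ (by omega)
          rw [show b - (d+1) + 1 = b - d by omega]
          exact ihd (by omega)
      have all' : ∀ j < b + 1, P j := fun j hj => by
        have := all (b - j) (by omega)
        rwa [show b - (b - j) = j by omega] at this
      refine ⟨b + 1, le_rfl, ?_, fun j hj => ⟨fun _ => hj, fun _ => all' j hj⟩⟩
      rw [Finset.filter_true_of_mem (fun j hj => all' j (Finset.mem_range.1 hj))]
      simp
    · refine ⟨n, by omega, ?_, ?_⟩
      · rw [Finset.range_add_one, Finset.filter_insert, if_neg hb, hc]
      · intro j hj
        rcases Nat.lt_succ_iff_lt_or_eq.1 hj with h1 | h1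
        · exact hP j h1
        · subst h1
          exact ⟨fun h => absurd h hb, fun h => by omega⟩

section
variable {a b : ℕ} {q : ℤ} {G : ℤ → ℤ → ℕ → ℕ → Prop}

theorem Growth.rc_spec (h : Growth a b q G) (s t : ℤ) {i : ℕ} (hi : i < a) :
    0 ≤ rc b G s i t ∧ rc b G s i t ≤ b ∧ ∀ j < b, (G s t i j ↔ (j : ℤ) < rc b G s i t) := by
  obtain ⟨n, hn, hc, hP⟩ := card_initial b (fun j => G s t i j)
    (fun j hj hG => h.tj _ _ _ _ hi hj (h.mono_t _ _ _ _ hi hj hG))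
  have : rc b G s i t = n := by unfold rc; exact_mod_cast hc
  rw [this]
  exact ⟨by omega, by omega, fun j hj => (hP j hj).trans (by omega)⟩

theorem le_of_bits {b : ℕ} {m n : ℤ} (hn : 0 ≤ n) (hm : m ≤ b)
    (h : ∀ j < b, (j : ℤ) < m → (j : ℤ) < n) : m ≤ n := by
  by_contra hlt
  have := h n.toNat (by omega) (by omega)
  omega

theorem Growth.rc_le (h : Growth a b q G) {s t s' t' : ℤ} {i i' : ℕ} (hi : i < a) (hi' : i' < a)
    (hh : ∀ j < b, G s t i j → G s' t' i' j) : rc b G s i t ≤ rc b G s' i' t' := by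
  obtain ⟨h1, h2, h3⟩ := h.rc_spec s t hi
  obtain ⟨h4, h5, h6⟩ := h.rc_spec s' t' hi'
  exact le_of_bits h4 h2 (fun j hj hm => (h6 j hj).1 (hh j hj ((h3 j hj).2 hm)))

theorem Growth.rc_le_succ (h : Growth a b q G) {s t s' t' : ℤ} {i i' : ℕ} (hi : i < a) (hi' : i' < a)
    (hh : ∀ j, j + 1 < b → G s t i (j+1) → G s' t' i' j) : rc b G s i t ≤ rc b G s' i' t' + 1 := by
  obtain ⟨h1, h2, h3⟩ := h.rc_spec s t hi
  obtain ⟨h4, h5, h6⟩ := h.rc_spec s' t' hi'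
  refine le_of_bits (by omega) h2 (fun j hj hm => ?_)
  rcases j with _ | j
  · push_cast; omega
  · have := (h6 j (by omega)).1 (hh j hj ((h3 (j+1) hj).2 hm))
    push_cast; omega

theorem Growth.key (h : Growth a b q G) {u : ℤ} {i : ℕ} (hi : i < a) {t : ℤ} (h1 : u < t)
    (h2 : t < u + q) (e0 : rc b G u i t = rc b G (u+1) i t)
    (e1 : rc b G u i (t+1) ≠ rc b G (u+1) i (t+1)) :
    ∃ i', i' + 1 = i ∧ rc b G (u+1) i' t ≤ rc b G (u+1) i t := by
  have A := h.rc_le_succ (s := u) (t := t+1) (s' := u) (t' := t) hi hi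
    (fun j hj hG => h.tj _ _ _ _ hi hj hG)
  have B := h.rc_le (s := u+1) (t := t) (s' := u+1) (t' := t+1) hi hi
    (fun j hj hG => h.mono_t _ _ _ _ hi hj hG)
  have C := h.rc_le (s := u+1) (t := t+1) (s' := u) (t' := t+1) hi hi
    (fun j hj hG => h.mono_s _ _ _ _ hi hj hG)
  obtain ⟨x1, x2, x3⟩ := h.rc_spec u t hi
  obtain ⟨w1, w2, w3⟩ := h.rc_spec u (t+1) hi
  obtain ⟨p1, p2, p3⟩ := h.rc_spec (u+1) t hi
  obtain ⟨y1, y2, y3⟩ := h.rc_spec (u+1) (t+1) hi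
  obtain ⟨j, hj⟩ := Int.eq_ofNat_of_zero_le x1
  have hjb : j < b := by omega
  have nx : ¬ G u t i j := by rw [x3 j hjb]; omega
  by_contra hcon
  push Not at hcon
  have T := h.tog u t i j hi hjb h1 h2 ((w3 j hjb).2 (by omega)) (by rw [p3 j hjb]; omega) ?_ ?_ ?_ ?_
  · rw [y3 j hjb] at T
    exact nx (T.2 (by omega))
  · intro i' hi'
    obtain ⟨z1, z2, z3⟩ := h.rc_spec (u+1) t (i := i') (by omega)
    have := hcon i' hi'
    exact (z3 j hjb).2 (by omega)
  · intro j' hj'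
    exact (p3 j' (by omega)).2 (by omega)
  · intro hh hG
    exact nx (h.ti _ _ _ _ hh hjb hG)
  · intro hh hG
    exact nx (h.tj _ _ _ _ hi hh hG)

theorem Growth.keyLong (h : Growth a b q G) {u : ℤ} {i : ℕ} (hi : i < a) {σ : ℤ} (h1 : u < σ)
    (e0 : rc b G u i σ = rc b G (u+1) i σ) (ρ : ℤ) (hρ : σ ≤ ρ) : ρ ≤ u + q →
    rc b G u i ρ ≠ rc b G (u+1) i ρ →
    ∃ i', i' + 1 = i ∧ ∃ t, σ ≤ t ∧ t ≤ ρ ∧ rc b G u i σ = rc b G (u+1) i σ ∧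
      rc b G (u+1) i' t ≤ rc b G (u+1) i t := by
  induction ρ, hρ using Int.leInduction with
  | base => intro _ h3; exact absurd e0 h3
  | succ n hn ih =>
    intro h2 h3
    by_cases e : rc b G u i n = rc b G (u+1) i n
    · obtain ⟨i', hi', hh⟩ := h.key hi (t := n) (by omega) (by omega) e h3
      exact ⟨i', hi', n, hn, by omega, e0, hh⟩
    · obtain ⟨i', hi', t, ht, ht', hh⟩ := ih (by omega) e
      exact ⟨i', hi', t, ht, by omega, hh⟩
end

def LPath (g : ℕ → ℤ → ℤ) (t : ℤ) : ℕ → ℤ → ℤ → Prop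
  | 0, σ, n => n ≤ g 0 t - g 0 σ
  | i+1, σ, n => ∃ ρ, σ ≤ ρ ∧ ρ ≤ t ∧ ∃ n', LPath g t i ρ n' ∧ n ≤ n' + g (i+1) ρ - g (i+1) σ

theorem LPath.extend {g : ℕ → ℤ → ℤ} {t : ℤ} {i : ℕ} {ρ ρ' n m : ℤ} (h : LPath g t i ρ n)
    (hρ : ρ' ≤ ρ) (hm : m ≤ n + g i ρ - g i ρ') : LPath g t i ρ' m := by
  cases i with
  | zero => simp only [LPath] at *; omega
  | succ i =>
    obtain ⟨x, h1, h2, n', h3, h4⟩ := h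
    exact ⟨x, by omega, h2, n', h3, by omega⟩

section
variable {a b : ℕ} {q : ℤ} {G : ℤ → ℤ → ℕ → ℕ → Prop}

theorem Growth.path_step (h : Growth a b q G) {u t : ℤ} (ht : t ≤ u + q) (i : ℕ) (hi : i < a) :
    ∀ σ n, u < σ → σ ≤ t → LPath (rc b G u) t i σ n → LPath (rc b G (u+1)) t i σ n := by
  have low : ∀ i < a, ∀ t, rc b G (u+1) i t ≤ rc b G u i t := fun i hi t =>
    h.rc_le hi hi (fun j hj hG => h.mono_s _ _ _ _ hi hj hG)
  have up : ∀ i < a, ∀ t, rc b G u i t ≤ rc b G (u+1) i t + 1 := fun i hi t =>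
    h.rc_le_succ hi hi (fun j hj hG => h.sj _ _ _ _ hi hj hG)
  induction i with
  | zero =>
    intro σ n h1 h2 h3
    simp only [LPath] at *
    have l1 := low 0 hi σ
    have l2 := up 0 hi t
    have l3 := low 0 hi t
    by_cases e0 : rc b G u 0 σ = rc b G (u+1) 0 σ
    · by_cases e1 : rc b G u 0 t = rc b G (u+1) 0 t
      · omega
      · obtain ⟨i', hi', _⟩ := h.keyLong hi h1 e0 t h2 ht e1
        omega
    · omega
  | succ i ih =>
    rintro σ n h1 h2 ⟨ρ, h3, h4, n', h5, h6⟩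
    have h5' := ih (by omega) ρ n' (by omega) h4 h5
    have l1 := low (i+1) hi σ
    have l2 := up (i+1) hi ρ
    have l3 := low (i+1) hi ρ
    have base : rc b G u (i+1) ρ - rc b G u (i+1) σ ≤
        rc b G (u+1) (i+1) ρ - rc b G (u+1) (i+1) σ →
        LPath (rc b G (u+1)) t (i+1) σ n := fun hh => ⟨ρ, h3, h4, n', h5', by omega⟩
    by_cases e0 : rc b G u (i+1) σ = rc b G (u+1) (i+1) σ
    · by_cases e1 : rc b G u (i+1) ρ = rc b G (u+1) (i+1) ρ
      · apply base; omega
      · obtain ⟨i', hi', x, hx1, hx2, _, hx⟩ := h.keyLong hi h1 e0 ρ h3 (by omega) e1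
        obtain rfl : i' = i := by omega
        have l4 : rc b G u (i'+1) ρ ≤ rc b G (u+1) i' ρ :=
          h.rc_le hi (by omega) (fun j hj hG => h.si _ _ _ _ hi hj hG)
        exact ⟨x, hx1, by omega, n' + rc b G (u+1) i' ρ - rc b G (u+1) i' x,
          h5'.extend hx2 le_rfl, by omega⟩
    · apply base; omega

theorem Growth.path_steps (h : Growth a b q G) {u s t : ℤ} (hst : s ≤ t) (i : ℕ) (hi : i < a)
    (n : ℤ) (ht : t ≤ u + q) (h0 : LPath (rc b G u) t i s n) (v : ℤ) (huv : u ≤ v) :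
    v ≤ s → LPath (rc b G v) t i s n := by
  induction v, huv using Int.leInduction with
  | base => intro _; exact h0
  | succ v hv ih =>
    intro hvs
    exact h.path_step (by omega) i hi s n (by omega) hst (ih (by omega))

theorem Growth.path_start (g : ℕ → ℤ → ℤ) (t : ℤ) (i : ℕ) : LPath g t i t 0 := by
  induction i with
  | zero => simp [LPath]
  | succ i ih => exact ⟨t, le_rfl, le_rfl, 0, ih, by omega⟩

theorem Growth.path_end (h : Growth a b q G) {s t : ℤ} (i : ℕ) (hi : i < a) :
    ∀ σ n, LPath (rc b G s) t i σ n → n ≤ rc b G s 0 t - rc b G s i σ := by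
  induction i with
  | zero => intro σ n h; exact h
  | succ i ih =>
    rintro σ n ⟨ρ, h1, h2, n', h3, h4⟩
    have := ih (by omega) ρ n' h3
    have : rc b G s (i+1) ρ ≤ rc b G s i ρ := h.rc_le hi (by omega)
      (fun j hj hG => h.ti _ _ _ _ hi hj (h.mono_t _ _ _ _ hi hj hG))
    omega

theorem Growth.ineq (h : Growth a b q G) (ha : 0 < a) {s t : ℤ} (hst : s ≤ t) (hts : t ≤ s + q) :
    (b : ℤ) ≤ rc b G (t - q) (a-1) s + rc b G s 0 t := by
  have h0 : LPath (rc b G (t-q)) t (a-1) s (rc b G (t-q) (a-1) t - rc b G (t-q) (a-1) s) :=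
    (Growth.path_start _ t (a-1)).extend hst (by omega)
  have h1 := h.path_steps hst (a-1) (by omega) _ (by omega) h0 s (by omega) le_rfl
  have h2 := h.path_end (a-1) (by omega) _ _ h1
  obtain ⟨x1, x2, x3⟩ := h.rc_spec (t-q) t (i := a-1) (by omega)
  obtain ⟨y1, y2, y3⟩ := h.rc_spec s s (i := a-1) (by omega)
  have : (b:ℤ) ≤ rc b G (t-q) (a-1) t := le_of_bits x1 le_rfl (fun j hj _ =>
    (x3 j hj).1 (h.full _ _ _ _ (by omega) hj (by omega)))
  omega

theorem Growth.rc_dual (h : Growth a b q G) (s t : ℤ) {i : ℕ} (hi : i < a) :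
    rc b (fun s t i j => ¬ G t (s + q) (a - 1 - i) (b - 1 - j)) s i t
      = b - rc b G t (a-1-i) (s+q) := by
  obtain ⟨x1, x2, x3⟩ := h.dual.rc_spec s t hi
  obtain ⟨y1, y2, y3⟩ := h.rc_spec t (s+q) (i := a-1-i) (by omega)
  apply le_antisymm
  · apply le_of_bits (b := b) (by omega) x2
    intro j hj hh
    have := (x3 j hj).2 hh
    simp only [y3 (b-1-j) (by omega)] at this
    omega
  · apply le_of_bits (b := b) x1 (by omega)
    intro j hj hh
    apply (x3 j hj).1
    simp only [y3 (b-1-j) (by omega)]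
    omega

theorem Growth.ineq_dual (h : Growth a b q G) (ha : 0 < a) {s t : ℤ} (hst : s ≤ t)
    (hts : t ≤ s + q) :
    rc b G s 0 t + rc b G t (a-1) (s+q) ≤ b := by
  have := h.dual.ineq ha hst hts
  rw [h.rc_dual _ _ (by omega), h.rc_dual _ _ ha] at this
  simp only [Nat.sub_self, Nat.sub_zero, sub_add_cancel] at this
  omega

theorem Growth.mono_shift (h : Growth a b q G) (ha : 0 < a) {e : ℤ} (he : 0 ≤ e) (heq : e ≤ q)
    (s : ℤ) : rc b G s 0 (s+e) ≤ rc b G (s+q) 0 (s+q+e) := by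
  have h1 := h.ineq ha (s := s+q) (t := s+q+e) (by omega) (by omega)
  have h2 := h.ineq_dual ha (s := s) (t := s+e) (by omega) (by omega)
  rw [show s + q + e - q = s + e by ring] at h1
  omega

theorem const_of_periodic (D : ℤ → ℤ) (k q : ℕ) (hk : 0 < k) (hkq : Nat.Coprime k q)
    (hD : ∀ s, D (s + k) = D s) (hq : ∀ s, D s ≤ D (s + q)) (s : ℤ) : D (s+1) = D s := by
  have pk : Function.Periodic D (k:ℤ) := hD
  have mon : ∀ n : ℕ, ∀ s, D s ≤ D (s + n * q) := by
    intro n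
    induction n with
    | zero => intro s; simp
    | succ n ih =>
      intro s
      refine (ih s).trans ((hq _).trans (le_of_eq ?_))
      congr 1; push_cast; ring
  have pq : Function.Periodic D (q:ℤ) := by
    intro s
    apply le_antisymm _ (hq s)
    have := mon (k-1) (s+q)
    refine this.trans (le_of_eq ?_)
    have e := pk.nat_mul q s
    rw [← e]
    congr 1
    rw [Nat.cast_sub hk]; push_cast; ring
  have hb := Nat.gcd_eq_gcd_ab k q
  rw [hkq] at hb
  have e1 := (pk.int_mul (Nat.gcdA k q)) s
  have e2 := (pq.int_mul (Nat.gcdB k q)) (s + (Nat.gcdA k q) * k)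
  simp only [Int.cast_id] at e1 e2
  rw [← e1, ← e2]
  congr 1
  push_cast at hb
  linarith

theorem Growth.firstRow {q : ℕ} (h : Growth a b q G) (ha : 0 < a) (hbq : b ≤ q) (k : ℕ) (hk : 0 < k)
    (hkq : Nat.Coprime k q) (hG : ∀ s t i j, G (s+k) (t+k) i j ↔ G s t i j) (j : ℕ) (hj : j < b) :
    ∀ s, G s (s+j+1) 0 j := by
  have const : ∀ e : ℤ, 0 ≤ e → e ≤ q → ∀ s, ∀ j < b, (G (s+1) (s+1+e) 0 j ↔ G s (s+e) 0 j) := by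
    intro e he heq s j hj
    have := const_of_periodic (fun s => rc b G s 0 (s+e)) k q hk hkq (fun s => ?_)
      (fun s => h.mono_shift ha he heq s) s
    · obtain ⟨x1, x2, x3⟩ := h.rc_spec (s+1) (s+1+e) ha
      obtain ⟨y1, y2, y3⟩ := h.rc_spec s (s+e) ha
      rw [x3 j hj, y3 j hj]
      rw [this]
    · apply le_antisymm
      · apply h.rc_le ha ha
        intro j hj
        rw [show s + k + e = s + e + k by ring]
        exact (hG _ _ _ _).1
      · apply h.rc_le ha ha
        intro j hj
        rw [show s + k + e = s + e + k by ring]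
        exact (hG _ _ _ _).2
  induction j with
  | zero =>
    intro s
    by_contra hcon
    have : ∀ d : ℤ, 1 ≤ d → d ≤ q → ¬ G s (s+d) 0 0 := by
      intro d hd
      induction d, hd using Int.leInduction with
      | base => intro _; simpa using hcon
      | succ d hd ih =>
        intro hdq hw
        have ih := ih (by omega)
        have np : ¬ G (s+1) (s+d) 0 0 := fun hp => ih (h.mono_s _ _ _ _ ha hj hp)
        have T := h.tog s (s+d) 0 0 ha hj (by omega) (by omega) (by rwa [add_assoc]) np
          (by simp) (by simp) (fun hh hG => ih (h.ti _ _ _ _ hh hj hG))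
          (fun hh hG => ih (h.tj _ _ _ _ ha hh hG))
        have := const d (by omega) (by omega) s 0 hj
        rw [show s + 1 + d = s + d + 1 by ring] at this
        tauto
    exact this q (by omega) le_rfl (h.full _ _ _ _ ha hj le_rfl)
  | succ j ihj =>
    have ihj := ihj (by omega)
    intro s
    by_contra hcon
    have : ∀ d : ℤ, (j:ℤ) + 2 ≤ d → d ≤ q → ¬ G s (s+d) 0 (j+1) ∧ G (s+1) (s+d) 0 j := by
      intro d hd
      induction d, hd using Int.leInduction with
      | base =>
        intro _
        constructor
        · convert hcon using 2; push_cast; ring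
        · have := ihj (s+1)
          convert this using 1; ring
      | succ d hd ih =>
        intro hdq
        obtain ⟨ih, ih2⟩ := ih (by omega)
        refine ⟨fun hw => ?_, ?_⟩
        · have np : ¬ G (s+1) (s+d) 0 (j+1) := fun hp => ih (h.mono_s _ _ _ _ ha hj hp)
          have T := h.tog s (s+d) 0 (j+1) ha hj (by omega) (by omega) (by rwa [add_assoc]) np
            (by simp) (by intro j' hj'; obtain rfl : j' = j := by omega
                          exact ih2) (fun hh hG => ih (h.ti _ _ _ _ hh hj hG))
            (fun hh hG => ih (h.tj _ _ _ _ ha hh hG))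
          have := const d (by omega) (by omega) s (j+1) hj
          rw [show s + 1 + d = s + d + 1 by ring] at this
          tauto
        · have := h.mono_t _ _ _ _ ha (by omega) ih2
          rwa [add_assoc] at this
    exact (this q (by omega) le_rfl).1 (h.full _ _ _ _ ha hj le_rfl)

theorem Growth.contra {q : ℕ} (h : Growth a b q G) (ha : 0 < a) (hb : 0 < b) (hq : a + b ≤ q)
    (k : ℕ) (hk : 0 < k)
    (hkq : Nat.Coprime k q) (hG : ∀ s t i j, G (s+k) (t+k) i j ↔ G s t i j) : False := by
  have h1 := h.firstRow ha (by omega) k hk hkq hG (b-1) (by omega)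
  have h2 := h.dual.transpose.firstRow hb (by omega) k hk hkq (by
    intro s t i j
    rw [show s + (k:ℤ) + q = s + q + k by ring, hG]) (a-1) (by omega) 0
  simp only [Nat.sub_self, Nat.sub_zero] at h2
  apply h2
  have mt : ∀ s t t', t ≤ t' → G s t 0 (b-1) → G s t' 0 (b-1) := by
    intro s t t' htt
    induction t', htt using Int.leInduction with
    | base => exact id
    | succ n hn ih => exact fun hh => h.mono_t _ _ _ _ ha (by omega) (ih hh)
  exact mt _ _ _ (by omega) (h1 _)
end

section rowm
variable {α : Type*} [PartialOrder α]

theorem row_ideal (I : Set α) : IsOrderIdeal (Rowmotion I) := by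
  rintro x y hxy ⟨m, h1, h2, h3⟩
  exact ⟨m, h1, h2, hxy.trans h3⟩

theorem row_lt {I : Set α} {x y : α} (h : x < y) (hy : y ∈ Rowmotion I) : x ∈ I := by
  obtain ⟨m, h1, h2, h3⟩ := hy
  exact h2 _ (h.trans_le h3)

theorem row_inj [Finite α] {I I' : Set α} (hI : IsOrderIdeal I) (hI' : IsOrderIdeal I')
    (h : Rowmotion I = Rowmotion I') : I = I' := by
  have main : ∀ I I' : Set α, IsOrderIdeal I → IsOrderIdeal I' → Rowmotion I = Rowmotion I' →
      I' ⊆ I := by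
    intro I I' hI hI' h x hx'
    by_contra hx
    obtain ⟨m, hmx, hm⟩ := exists_minimal_le_of_wellFoundedLT (fun y => y ∉ I) x hx
    have hm2 : ∀ y, y < m → y ∈ I := fun y hy => by
      by_contra hyI
      exact hm.not_lt hyI hy
    have m1 : m ∈ Rowmotion I := ⟨m, hm.prop, hm2, le_rfl⟩
    rw [h] at m1
    obtain ⟨m', h1, h2, h3⟩ := m1
    have m2 : m' ∈ Rowmotion I' := ⟨m', h1, h2, le_rfl⟩
    rw [← h] at m2
    obtain ⟨m'', h4, h5, h6⟩ := m2
    rcases (h3.trans h6).lt_or_eq with h7 | h7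
    · exact hm.prop (h5 _ h7)
    · have : m = m' := le_antisymm h3 (h7 ▸ h6)
      exact h1 (hI' (this ▸ hmx) hx')
  exact subset_antisymm (main I' I hI' hI h.symm) (main I I' hI hI' h)

theorem iter_ideal {I : Set α} (hI : IsOrderIdeal I) (n : ℕ) :
    IsOrderIdeal (Rowmotion^[n] I) := by
  cases n with
  | zero => exact hI
  | succ n => rw [Function.iterate_succ_apply']; exact row_ideal _

theorem row_periodic [Finite α] {I : Set α} (hI : IsOrderIdeal I) :
    I ∈ Function.periodicPts (Rowmotion (α := α)) := by
  obtain ⟨m, n, hmn, he⟩ := Finite.exists_ne_map_eq_of_infinite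
    (fun n : ℕ => (Rowmotion^[n] I : Set α))
  have cancel : ∀ m d, Rowmotion^[m] I = Rowmotion^[m+d] I → I = Rowmotion^[d] I := by
    intro m d
    induction m with
    | zero => intro h; simpa using h
    | succ m ih =>
      intro h
      rw [show m + 1 + d = (m + d) + 1 by ring, Function.iterate_succ_apply',
        Function.iterate_succ_apply'] at h
      exact ih (row_inj (iter_ideal hI _) (iter_ideal hI _) h)
  rcases lt_or_gt_of_ne hmn with hl | hl
  · refine ⟨n - m, by omega, ?_⟩
    exact (cancel m (n-m) (by rwa [show m + (n - m) = n by omega])).symm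
  · refine ⟨m - n, by omega, ?_⟩
    exact (cancel n (m-n) (by rw [show n + (m - n) = m by omega]; exact he.symm)).symm

theorem orbit_card [Finite α] {I : Set α} (hI : IsOrderIdeal I) :
    ({J | ∃ n : ℕ, Rowmotion^[n] I = J} : Set (Set α)).ncard
      = Function.minimalPeriod Rowmotion I := by
  have : ({J | ∃ n : ℕ, Rowmotion^[n] I = J} : Set (Set α)) =
      (fun n => Rowmotion^[n] I) '' (Set.Iio (Function.minimalPeriod Rowmotion I)) := by
    ext J
    constructor
    · rintro ⟨n, rfl⟩
      exact ⟨n % Function.minimalPeriod Rowmotion I,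
        Nat.mod_lt _ (Function.minimalPeriod_pos_of_mem_periodicPts (row_periodic hI)),
        Function.iterate_mod_minimalPeriod_eq⟩
    · rintro ⟨n, _, rfl⟩
      exact ⟨n, rfl⟩
  rw [this, Set.InjOn.ncard_image Function.iterate_injOn_Iio_minimalPeriod]
  simp
end rowm

section box
variable {a b c : ℕ}

/-- membership with out of range conventions in the third coordinate -/
def bit (I : Set (Fin a × Fin b × Fin c)) (i j : ℕ) (z : ℤ) : Prop :=
  z < 0 ∨ ∃ (hi : i < a) (hj : j < b) (hz : z.toNat < c),
    ((⟨i, hi⟩, ⟨j, hj⟩, ⟨z.toNat, hz⟩) : Fin a × Fin b × Fin c) ∈ I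

theorem bit_mono {I : Set (Fin a × Fin b × Fin c)} (hI : IsOrderIdeal I) {i j i' j' : ℕ} {z z' : ℤ}
    (hi : i ≤ i') (hj : j ≤ j') (hz : z ≤ z') (h : bit I i' j' z') : bit I i j z := by
  by_cases h0 : z < 0
  · exact Or.inl h0
  · rcases h with h | ⟨h1, h2, h3, h⟩
    · omega
    · refine Or.inr ⟨by omega, by omega, by omega, hI ?_ h⟩
      refine ⟨hi, hj, ?_⟩
      show z.toNat ≤ z'.toNat
      omega

theorem bit_row {I : Set (Fin a × Fin b × Fin c)} {i j i' j' : ℕ} {z z' : ℤ}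
    (hi : i ≤ i') (hj : j ≤ j') (hz : z ≤ z') (hne : i < i' ∨ j < j' ∨ z < z')
    (h : bit (Rowmotion I) i' j' z') : bit I i j z := by
  by_cases h0 : z < 0
  · exact Or.inl h0
  · rcases h with h | ⟨h1, h2, h3, h⟩
    · omega
    · refine Or.inr ⟨by omega, by omega, by omega, row_lt ?_ h⟩
      refine lt_of_le_of_ne ⟨hi, hj, ?_⟩ ?_
      · show z.toNat ≤ z'.toNat
        omega
      · intro he
        simp only [Prod.mk.injEq, Fin.mk.injEq] at he
        omega

theorem bit_toggle {I : Set (Fin a × Fin b × Fin c)} (hI : IsOrderIdeal I) {i j : ℕ} {z : ℤ}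
    (hi : i < a) (hj : j < b) (hz0 : 0 ≤ z) (hzc : z < c)
    (h1 : bit I i j (z-1)) (h2 : ¬ bit (Rowmotion I) i j (z+1))
    (h3 : ∀ i', i' + 1 = i → bit I i' j z) (h4 : ∀ j', j' + 1 = j → bit I i j' z)
    (h5 : i + 1 < a → ¬ bit (Rowmotion I) (i+1) j z)
    (h6 : j + 1 < b → ¬ bit (Rowmotion I) i (j+1) z) :
    bit I i j z ↔ ¬ bit (Rowmotion I) i j z := by
  have hzt : z.toNat < c := by omega
  constructor
  · rintro (h | ⟨_, _, _, hx⟩) hy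
    · omega
    rcases hy with hy | ⟨_, _, _, hy⟩
    · omega
    obtain ⟨⟨⟨m1, hm1⟩, ⟨m2, hm2⟩, ⟨m3, hm3⟩⟩, hm, hmin, hle⟩ := hy
    obtain ⟨le1, le2, le3⟩ := hle
    change i ≤ m1 at le1
    change j ≤ m2 at le2
    change z.toNat ≤ m3 at le3
    have bm : bit (Rowmotion I) m1 m2 m3 := Or.inr ⟨hm1, hm2, by simpa using hm3, by
      simp only [Int.toNat_natCast]
      exact ⟨_, hm, hmin, le_rfl⟩⟩
    have mo := fun i' j' z' h1 h2 h3 => bit_mono (row_ideal I) (i := i') (j := j') (z := z') h1 h2 h3 bm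
    by_cases c1 : i < m1
    · exact h5 (by omega) (mo _ _ _ (by omega) (by omega) (by omega))
    by_cases c2 : j < m2
    · exact h6 (by omega) (mo _ _ _ (by omega) (by omega) (by omega))
    by_cases c3 : z.toNat < m3
    · exact h2 (mo _ _ _ (by omega) (by omega) (by omega))
    obtain rfl : i = m1 := by omega
    obtain rfl : j = m2 := by omega
    obtain rfl : z.toNat = m3 := by omega
    exact hm hx
  · intro hy
    by_contra hx
    apply hy
    refine Or.inr ⟨hi, hj, hzt, _, fun hh => hx (Or.inr ⟨hi, hj, hzt, hh⟩), ?_, le_rfl⟩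
    rintro ⟨⟨m1, hm1⟩, ⟨m2, hm2⟩, ⟨m3, hm3⟩⟩ hlt
    obtain ⟨le1, le2, le3⟩ := hlt.le
    have hne := hlt.ne
    simp only [ne_eq, Prod.mk.injEq, Fin.mk.injEq] at hne
    change m1 ≤ i at le1
    change m2 ≤ j at le2
    change m3 ≤ z.toNat at le3
    suffices hs : bit I m1 m2 m3 by
      rcases hs with hs | ⟨_, _, _, hs⟩
      · omega
      · simpa using hs
    by_cases c1 : m1 < i
    · exact bit_mono hI (by omega) le2 (by omega) (h3 (i-1) (by omega))
    by_cases c2 : m2 < j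
    · exact bit_mono hI le1 (by omega) (by omega) (h4 (j-1) (by omega))
    exact bit_mono hI le1 le2 (by omega) h1

theorem growth_of_row (J : ℤ → Set (Fin a × Fin b × Fin c)) (hJ : ∀ τ, IsOrderIdeal (J τ))
    (hR : ∀ τ, J (τ+1) = Rowmotion (J τ)) (ha : 0 < a) (hb : 0 < b) (hc : 0 < c) :
    Growth a b ((a + b + c - 1 : ℕ) : ℤ)
      (fun s t i j => bit (J (s + i + j)) i j (i + j + s - t + c)) where
  mono_t s t i j hi hj hh := bit_mono (hJ _) le_rfl le_rfl (by omega) hh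
  mono_s s t i j hi hj hh := by
    rw [show s + 1 + (i:ℤ) + j = s + i + j + 1 by ring, hR] at hh
    exact bit_row le_rfl le_rfl (by omega) (by omega) hh
  ti s t i j hi hj hh := by
    rw [show s + ((i + 1 : ℕ):ℤ) + j = s + i + j + 1 by push_cast; ring, hR] at hh
    exact bit_row (by omega) le_rfl (by push_cast; omega) (by omega) hh
  tj s t i j hi hj hh := by
    rw [show s + (i:ℤ) + ((j + 1 : ℕ):ℤ) = s + i + j + 1 by push_cast; ring, hR] at hh
    exact bit_row (by omega) (by omega) (by push_cast; omega) (by omega) hh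
  si s t i j hi hj hh := by
    rw [show s + ((i + 1 : ℕ):ℤ) + j = s + 1 + i + j by push_cast; ring] at hh
    exact bit_mono (hJ _) (by omega) le_rfl (by push_cast; omega) hh
  sj s t i j hi hj hh := by
    rw [show s + (i:ℤ) + ((j + 1 : ℕ):ℤ) = s + 1 + i + j by push_cast; ring] at hh
    exact bit_mono (hJ _) (by omega) (by omega) (by push_cast; omega) hh
  emp s t i j hi hj hh := by
    rintro (h | ⟨_, _, h, _⟩)
    · omega
    · omega
  full s t i j hi hj hh := Or.inl (by omega)
  tog s t i j hi hj h1 h2 h3 h4 h5 h6 h7 h8 := by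
    have e1 : s + 1 + (i:ℤ) + j = s + i + j + 1 := by ring
    simp only [e1, hR] at h3 h4 ⊢
    set z : ℤ := i + j + s - t + c with hz
    rw [show (i:ℤ) + j + s - (t+1) + c = z - 1 by omega] at h3
    rw [show (i:ℤ) + j + (s+1) - t + c = z + 1 by omega] at h4
    rw [show (i:ℤ) + j + (s+1) - (t+1) + c = z by omega]
    have h5' : ∀ i', i' + 1 = i → bit (J (s + i + j)) i' j z := by
      intro i' hi'
      have := h5 i' hi'
      convert this using 2 <;> omega
    have h6' : ∀ j', j' + 1 = j → bit (J (s + i + j)) i j' z := by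
      intro j' hj'
      have := h6 j' hj'
      convert this using 2 <;> omega
    have h7' : i + 1 < a → ¬ bit (Rowmotion (J (s + i + j))) (i+1) j z := by
      intro hh
      have := h7 hh
      rw [← hR]
      convert this using 3 <;> push_cast <;> omega
    have h8' : j + 1 < b → ¬ bit (Rowmotion (J (s + i + j))) i (j+1) z := by
      intro hh
      have := h8 hh
      rw [← hR]
      convert this using 3 <;> push_cast <;> omega
    have hz0 : 0 ≤ z := by
      by_contra hneg
      have i1 : ¬ i + 1 < a := fun hh => h7' hh (Or.inl (by omega))
      have i2 : ¬ j + 1 < b := fun hh => h8' hh (Or.inl (by omega))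
      have i3 : ¬ z + 1 < 0 := fun hh => h4 (Or.inl hh)
      omega
    have hzc : z < c := by
      by_contra hbig
      have big : ∀ K : Set (Fin a × Fin b × Fin c), ∀ i j z', (c:ℤ) ≤ z' → ¬ bit K i j z' := by
        rintro K i j z' hz' (h | ⟨_, _, h, _⟩) <;> omega
      have i1 : i = 0 := by
        by_contra hne
        exact big _ _ _ _ (by omega) (h5' (i-1) (by omega))
      have i2 : j = 0 := by
        by_contra hne
        exact big _ _ _ _ (by omega) (h6' (j-1) (by omega))
      omega
    exact bit_toggle (hJ _) hi hj hz0 hzc h3 h4 h5' h6' h7' h8'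
end box

/-- **Theorem (main theorem).** Let `a, b, c` be positive integers and let `k` be the
cardinality of any Ψ-orbit of rowmotion on the order ideals of
`B_{a,b,c} = Fin a × Fin b × Fin c`. Then `gcd(k, a + b + c - 1) > 1`. -/
theorem rowmotion_orbit_gcd (a b c : ℕ) (ha : 0 < a) (hb : 0 < b) (hc : 0 < c)
    (I : Set (Fin a × Fin b × Fin c)) (hI : IsOrderIdeal I) (k : ℕ)
    (hk : ({J | ∃ n : ℕ, Rowmotion^[n] I = J} : Set (Set (Fin a × Fin b × Fin c))).ncard = k) :
    1 < Nat.gcd k (a + b + c - 1) := by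
  rw [orbit_card hI] at hk
  have hkpos : 0 < k := hk ▸ Function.minimalPeriod_pos_of_mem_periodicPts (row_periodic hI)
  have hper : Rowmotion^[k] I = I := by
    rw [← hk]; exact Function.iterate_minimalPeriod
  by_contra hcon
  have hg : 0 < Nat.gcd k (a + b + c - 1) := Nat.gcd_pos_of_pos_left _ hkpos
  have hco : Nat.Coprime k (a + b + c - 1) := by unfold Nat.Coprime; omega
  let J : ℤ → Set (Fin a × Fin b × Fin c) := fun τ => Rowmotion^[(τ % k).toNat] I
  have hJk : ∀ τ, J (τ + k) = J τ := fun τ => by simp [J]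
  have hR : ∀ τ, J (τ+1) = Rowmotion (J τ) := by
    intro τ
    simp only [J]
    rw [← Function.iterate_succ_apply' Rowmotion]
    have h0 := Int.emod_nonneg τ (b := (k:ℤ)) (by omega)
    have h1 := Int.emod_lt_of_pos τ (b := (k:ℤ)) (by omega)
    rcases eq_or_lt_of_le (show τ % k + 1 ≤ k by omega) with h | h
    · have e : (τ + 1) % k = 0 := by
        rw [← Int.emod_add_emod, h, Int.emod_self]
      rw [e, show (τ % k).toNat.succ = k by omega, hper]
      rfl
    · have e : (τ + 1) % k = τ % k + 1 := by
        rw [← Int.emod_add_emod, Int.emod_eq_of_lt (by omega) h]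
      rw [e]
      congr 1
      omega
  have gr := growth_of_row J (fun τ => iter_ideal hI _) hR ha hb hc
  refine gr.contra ha hb (by omega) k hkpos hco ?_
  intro s t i j
  rw [show s + (k:ℤ) + i + j = s + i + j + k by ring, hJk,
    show (i:ℤ) + j + (s + k) - (t + k) + c = i + j + s - t + c by ring]
end

section
/- Let a, b be positive integers, let q > a+b−1, and suppose the K-promotion orbit of a tableau T ∈ Inc^q(a × b) has cardinality k. Then gcd(k, q) > 1. -/
open scoped Classical

/-- Two boxes of the `a × b` grid are adjacent if they share an edge. -/
def Adj {a b : ℕ} (x y : Fin a × Fin b) : Prop :=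
  (x.1 = y.1 ∧ ((x.2 : ℕ) + 1 = (y.2 : ℕ) ∨ (y.2 : ℕ) + 1 = (x.2 : ℕ))) ∨
  (x.2 = y.2 ∧ ((x.1 : ℕ) + 1 = (y.1 : ℕ) ∨ (y.1 : ℕ) + 1 = (x.1 : ℕ)))

/-- `IncTab a b q T` says `T` is an increasing tableau of shape `a × b`
(rows strictly increase left-to-right, columns strictly increase top-to-bottom)
with positive entries, all at most `q`; i.e. `T ∈ Inc^q(a × b)`. -/
def IncTab (a b q : ℕ) (T : Fin a × Fin b → ℕ) : Prop :=
  (∀ x, 1 ≤ T x ∧ T x ≤ q) ∧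
  (∀ (i : Fin a) (j₁ j₂ : Fin b), j₁ < j₂ → T (i, j₁) < T (i, j₂)) ∧
  (∀ (i₁ i₂ : Fin a) (j : Fin b), i₁ < i₂ → T (i₁, j) < T (i₂, j))

/-- In the filling `f`, boxes `x` and `y` lie in a common edge-connected
component (short ribbon) of the set of boxes labeled `1` or `t`. -/
def SameRibbon {a b : ℕ} (t : ℕ) (f : Fin a × Fin b → ℕ) (x y : Fin a × Fin b) : Prop :=
  Relation.ReflTransGen
    (fun u v => Adj u v ∧ (f u = 1 ∨ f u = t) ∧ (f v = 1 ∨ f v = t)) x y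

/-- One step of the K-promotion algorithm at value `t`: in every nontrivial
edge-connected component of the set of boxes labeled `1` or `t`, the labels
`1` and `t` are swapped; boxes in trivial components are unchanged. -/
noncomputable def BKstep {a b : ℕ} (t : ℕ) (f : Fin a × Fin b → ℕ) :
    Fin a × Fin b → ℕ := fun x =>
  if ∃ y, y ≠ x ∧ SameRibbon t f x y then
    (if f x = 1 then t else if f x = t then 1 else f x)
  else f x

/-- The intermediate filling obtained from `f` after performing the swap steps
for the values `2, 3, …, t - 1` (so `sweepUpTo t f` is the filling in force
when the step for value `t` is about to be performed). -/
noncomputable def sweepUpTo {a b : ℕ} (t : ℕ) (f : Fin a × Fin b → ℕ) :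
    Fin a × Fin b → ℕ :=
  (List.range' 2 (t - 2)).foldl (fun g s => BKstep s g) f

/-- K-promotion `Ψ : Inc^q(a × b) → Inc^q(a × b)`: perform the swap steps for
`t = 2, …, q`, then decrement every entry by `1`, replacing a resulting `0`
by `q`. -/
noncomputable def KPro {a b : ℕ} (q : ℕ) (T : Fin a × Fin b → ℕ) :
    Fin a × Fin b → ℕ := fun x =>
  if sweepUpTo (q + 1) T x = 1 then q else sweepUpTo (q + 1) T x - 1

/-- The Ψ-orbit of `T` under K-promotion. -/
noncomputable def PsiOrbit {a b : ℕ} (q : ℕ) (T : Fin a × Fin b → ℕ) :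
    Set (Fin a × Fin b → ℕ) :=
  {U | ∃ n : ℕ, (KPro q)^[n] T = U}

/-- The pair `{x, y}` of adjacent boxes belongs to the flow path of `V`:
at the step for some value `t ∈ {2, …, q}`, both boxes carry label `1` or `t`,
so they form part of a common nontrivial short ribbon whose labels are swapped. -/
def FlowPath {a b : ℕ} (q : ℕ) (V : Fin a × Fin b → ℕ) (x y : Fin a × Fin b) : Prop :=
  Adj x y ∧ ∃ t, 2 ≤ t ∧ t ≤ q ∧
    (sweepUpTo t V x = 1 ∨ sweepUpTo t V x = t) ∧
    (sweepUpTo t V y = 1 ∨ sweepUpTo t V y = t)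

/-- The stream-bed of `V`: boxes appearing in some pair of the flow path. -/
def StreamBed {a b : ℕ} (q : ℕ) (V : Fin a × Fin b → ℕ) (x : Fin a × Fin b) : Prop :=
  ∃ y, FlowPath q V x y ∨ FlowPath q V y x

/-- The box `x` lies in the frame of the `a × b` grid (first or last row,
or first or last column). -/
def InFrame {a b : ℕ} (x : Fin a × Fin b) : Prop :=
  (x.1 : ℕ) = 0 ∨ (x.1 : ℕ) = a - 1 ∨ (x.2 : ℕ) = 0 ∨ (x.2 : ℕ) = b - 1

/-- `Frame(V) = Frame(W)`: the fillings agree on all frame boxes. -/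
def FrameEq {a b : ℕ} (V W : Fin a × Fin b → ℕ) : Prop :=
  ∀ x, InFrame x → V x = W x

/-- The minimal tableau `M_{a×b}`, with entries `M(i,j) = i + j - 1`
(in 1-based coordinates; here coordinates are 0-based). -/
def MinTab (a b : ℕ) : Fin a × Fin b → ℕ := fun x => (x.1 : ℕ) + (x.2 : ℕ) + 1


/-- chains of length `n` going strictly east, weakly north, with increasing labels in `(s, M]` -/
def Up (a b M : ℕ) (F : ℕ → ℕ → ℕ) : ℕ → ℕ → ℕ → ℕ → Prop
  | 0, _, _, _ => True
  | n + 1, r, c, s => ∃ r' c', r' ≤ r ∧ c ≤ c' ∧ r' < a ∧ c' < b ∧ s < F r' c' ∧ F r' c' ≤ M ∧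
      Up a b M F n r' (c' + 1) (F r' c')

structure Slide (a b t0 : ℕ) (A B : ℕ → ℕ → ℕ) : Prop where
  Ar : ∀ r c, r < a → c + 1 < b → A r c < A r (c + 1)
  Ac : ∀ r c, r + 1 < a → c < b → A r c < A (r + 1) c
  Br : ∀ r c, r < a → c + 1 < b → B r c < B r (c + 1)
  Bc : ∀ r c, r + 1 < a → c < b → B r c < B (r + 1) c
  R1 : ∀ r c, r < a → c < b → A r c ≤ B r c
  R2r : ∀ r c, r < a → c + 1 < b → B r c ≤ A r (c + 1)
  R2c : ∀ r c, r + 1 < a → c < b → B r c ≤ A (r + 1) c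
  R4 : ∀ r c, r < a → c < b → t0 < A r c → A r c < B r c →
    (∃ c', c = c' + 1 ∧ B r c' = A r c) ∨ (∃ r', r = r' + 1 ∧ B r' c = A r c)

theorem Up.weaken {a b M : ℕ} {F : ℕ → ℕ → ℕ} {n r c s r' c' s' : ℕ} (h : Up a b M F n r c s)
    (hr : r ≤ r') (hc : c' ≤ c) (hs : s' ≤ s) : Up a b M F n r' c' s' := by
  cases n with
  | zero => trivial
  | succ n =>
    obtain ⟨x, y, h1, h2, h3, h4, h5, h6, h7⟩ := h
    exact ⟨x, y, by omega, by omega, h3, h4, by omega, h6, h7⟩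

theorem row_mono {b : ℕ} {f : ℕ → ℕ} (h : ∀ c, c + 1 < b → f c < f (c + 1)) {c d : ℕ}
    (hcd : c ≤ d) (hd : d < b) : f c ≤ f d := by
  induction d, hcd using Nat.le_induction with
  | base => exact le_rfl
  | succ d hd' ih => exact (ih (by omega)).trans (h d hd).le

theorem row_smono {b : ℕ} {f : ℕ → ℕ} (h : ∀ c, c + 1 < b → f c < f (c + 1)) {c d : ℕ}
    (hcd : c < d) (hd : d < b) : f c < f d :=
  (h c (by omega)).trans_le (row_mono h (c := c + 1) hcd hd)

theorem Up.shift {a b M t0 : ℕ} {A B : ℕ → ℕ → ℕ} (S : Slide a b t0 A B) {n r : ℕ} :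
    ∀ {c s : ℕ}, Up a b M A n (r + 1) c s → (∀ d, c ≤ d → d < b → s < A r d) →
      Up a b M A n r c s := by
  induction n with
  | zero => intros; trivial
  | succ n ih =>
    intro c s h hs
    obtain ⟨x, y, h1, h2, h3, h4, h5, h6, h7⟩ := h
    by_cases hx : x ≤ r
    · exact ⟨x, y, hx, h2, h3, h4, h5, h6, h7⟩
    · obtain rfl : x = r + 1 := by omega
      have := S.Ac r y h3 h4
      refine ⟨r, y, le_rfl, h2, by omega, h4, hs y h2 h4, by omega, ?_⟩
      refine ih (h7.weaken le_rfl le_rfl this.le) ?_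
      intro d hd hdb
      exact row_smono (fun c hc => S.Ar r c (by omega) hc) hd hdb

theorem Up.slide_aux {a b M t0 : ℕ} {A B : ℕ → ℕ → ℕ} (S : Slide a b t0 A B) (n : ℕ) :
    (∀ r c s, t0 ≤ s → r < a → Up a b M A n r c s →
      (∀ c', c = c' + 1 → ∃ r', r ≤ r' ∧ r' < a ∧ c' < b ∧ B r' c' ≤ s) →
      Up a b M B n r c s) ∧
    (∀ r c, r < a → c < b → t0 ≤ B r c → B r c ≤ M → Up a b M A n (r + 1) (c + 1) (B r c) →
      Up a b M B n r (c + 1) (B r c)) := by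
  induction n with
  | zero => exact ⟨fun _ _ _ _ _ _ _ => trivial, fun _ _ _ _ _ _ _ => trivial⟩
  | succ n ih =>
    obtain ⟨ih1, ih3⟩ := ih
    have key : ∀ r c s, t0 ≤ s → r < a → Up a b M A (n + 1) r c s →
      (∀ c', c = c' + 1 → ∃ r', r ≤ r' ∧ r' < a ∧ c' < b ∧ B r' c' ≤ s) →
      Up a b M B (n + 1) r c s := by
      intro r c s hs hra h hp
      obtain ⟨x, y, h1, h2, h3, h4, h5, h6, h7⟩ := h
      by_cases hAB : A x y = B x y
      · refine ⟨x, y, h1, h2, h3, h4, by omega, by omega, ?_⟩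
        rw [← hAB]
        refine ih1 _ _ _ (by omega) h3 h7 ?_
        intro c' hc'
        obtain rfl : y = c' := by omega
        exact ⟨x, le_rfl, h3, h4, hAB.ge⟩
      · have := S.R1 x y h3 h4
        rcases S.R4 x y h3 h4 (by omega) (by omega) with ⟨c', rfl, hc'⟩ | ⟨r', rfl, hr'⟩
        · have hcc : c ≤ c' := by
            by_contra hcon
            obtain rfl : c = c' + 1 := by omega
            obtain ⟨r', g1, g2, g3, g4⟩ := hp c' rfl
            have : B x c' ≤ B r' c' := row_mono (f := fun r => B r c') (b := a)
              (fun r hr => S.Bc r c' hr g3) (by omega) g2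
            omega
          refine ⟨x, c', h1, hcc, h3, by omega, by omega, by omega, ?_⟩
          rw [hc']
          refine ih1 _ _ _ (by omega) h3 (h7.weaken le_rfl (by omega) le_rfl) ?_
          intro c'' hc''
          obtain rfl : c' = c'' := by omega
          exact ⟨x, le_rfl, h3, by omega, hc'.le⟩
        · refine ⟨r', y, by omega, h2, by omega, h4, by omega, by omega, ?_⟩
          refine ih3 r' y (by omega) h4 (by omega) (by omega) ?_
          rw [hr']; exact h7
    refine ⟨key, ?_⟩
    intro r c hr hc ht hM h
    have hprev : ∀ c', c + 1 = c' + 1 → ∃ r', r ≤ r' ∧ r' < a ∧ c' < b ∧ B r' c' ≤ B r c := by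
      intro c' hc'
      obtain rfl : c = c' := by omega
      exact ⟨r, le_rfl, hr, hc, le_rfl⟩
    obtain ⟨x, y, h1, h2, h3, h4, h5, h6, h7⟩ := h
    by_cases hx : x ≤ r
    · exact key _ _ _ ht hr ⟨x, y, hx, h2, h3, h4, h5, h6, h7⟩ hprev
    obtain rfl : x = r + 1 := by omega
    by_cases hA : B r c < A r y
    · have hup : Up a b M A (n + 1) r y (B r c) := by
        refine Up.shift S (r := r) ⟨r + 1, y, le_rfl, le_rfl, h3, h4, h5, h6, h7⟩ ?_
        intro d hd hdb
        exact hA.trans_le (row_mono (fun c hc => S.Ar r c (by omega) hc) hd hdb)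
      exact key _ _ _ ht hr (hup.weaken le_rfl h2 le_rfl) hprev
    · have e1 := S.R2r r c hr (by omega)
      have hy : y = c + 1 := by
        by_contra hne
        have : A r (c + 1) < A r y := row_smono (fun c hc => S.Ar r c (by omega) hc) (by omega) h4
        omega
      subst hy
      have e2 := S.Br r c hr h4
      have e3 := S.R2c r (c + 1) h3 h4
      refine ⟨r, c + 1, le_rfl, le_rfl, hr, h4, e2, by omega, ?_⟩
      exact ih3 r (c + 1) hr h4 (by omega) (by omega) (h7.weaken le_rfl le_rfl e3)

theorem Up.slide {a b M t0 : ℕ} {A B : ℕ → ℕ → ℕ} (S : Slide a b t0 A B) {n : ℕ} (ha : 0 < a)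
    (h : Up a b M A n (a - 1) 0 t0) : Up a b M B n (a - 1) 0 t0 :=
  (Up.slide_aux S n).1 _ _ _ le_rfl (by omega) h (fun c' hc' => by omega)

theorem Up.last {a b M : ℕ} {F : ℕ → ℕ → ℕ} {n : ℕ} : ∀ {r c s : ℕ}, Up a b M F (n + 1) r c s →
    ∃ r' c', c + n ≤ c' ∧ r' < a ∧ c' < b ∧ s < F r' c' ∧ F r' c' ≤ M := by
  induction n with
  | zero =>
    rintro r c s ⟨x, y, h1, h2, h3, h4, h5, h6, h7⟩
    exact ⟨x, y, h2, h3, h4, h5, h6⟩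
  | succ n ih =>
    rintro r c s ⟨x, y, h1, h2, h3, h4, h5, h6, h7⟩
    obtain ⟨r', c', g1, g2, g3, g4, g5⟩ := ih h7
    exact ⟨r', c', by omega, g2, g3, by omega, g5⟩

theorem Up.init {a b M : ℕ} {F : ℕ → ℕ → ℕ} {n : ℕ} (ha : 0 < a)
    (hF : ∀ c, c + 1 < b → F (a - 1) c < F (a - 1) (c + 1)) : ∀ {c s : ℕ}, c + n = b →
    (∀ d, c ≤ d → d < b → s < F (a - 1) d ∧ F (a - 1) d ≤ M) → Up a b M F n (a - 1) c s := by
  induction n with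
  | zero => intros; trivial
  | succ n ih =>
    intro c s hc h
    have := h c le_rfl (by omega)
    refine ⟨a - 1, c, le_rfl, le_rfl, by omega, by omega, this.1, this.2, ?_⟩
    refine ih (by omega) ?_
    intro d hd hdb
    exact ⟨row_smono hF hd hdb, (h d (by omega) hdb).2⟩

theorem slides {a b M t0 N : ℕ} (ha : 0 < a) {A : ℕ → ℕ → ℕ → ℕ}
    (S : ∀ k < N, Slide a b t0 (A k) (A (k + 1)))
    (hF : ∀ c, c + 1 < b → A 0 (a - 1) c < A 0 (a - 1) (c + 1))
    {c : ℕ} (hc : c < b) (h : ∀ d, c ≤ d → d < b → t0 < A 0 (a - 1) d ∧ A 0 (a - 1) d ≤ M) :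
    ∃ r' c', b - 1 - c ≤ c' ∧ r' < a ∧ c' < b ∧ t0 < A N r' c' ∧ A N r' c' ≤ M := by
  have h0 : Up a b M (A 0) (b - 1 - c + 1) (a - 1) 0 t0 :=
    (Up.init ha hF (c := c) (by omega) h).weaken le_rfl (by omega) le_rfl
  have : ∀ k ≤ N, Up a b M (A k) (b - 1 - c + 1) (a - 1) 0 t0 := by
    intro k
    induction k with
    | zero => intro _; exact h0
    | succ k ih => intro hk; exact Up.slide (S k (by omega)) ha (ih (by omega))
  obtain ⟨r', c', g⟩ := (this N le_rfl).last
  exact ⟨r', c', by omega, g.2⟩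

structure Growth_s2 (a b q : ℕ) (h : ℕ → ℕ → ℕ → ℕ) : Prop where
  F0r : ∀ i r c, r < a → c + 1 < b → h i r c < h i r (c + 1)
  F0c : ∀ i r c, r + 1 < a → c < b → h i r c < h i (r + 1) c
  F1 : ∀ i r c, r < a → c < b → i + 1 ≤ h i r c ∧ h i r c ≤ i + q
  F2 : ∀ i r c, r < a → c < b → h i r c ≤ h (i + 1) r c
  F2r : ∀ i r c, r < a → c + 1 < b → h (i + 1) r c ≤ h i r (c + 1)
  F2c : ∀ i r c, r + 1 < a → c < b → h (i + 1) r c ≤ h i (r + 1) c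
  F3 : ∀ i r c, r < a → c < b → h i r c < h (i + 1) r c → h (i + 1) r c ≤ i + q →
    (c + 1 < b ∧ h i r (c + 1) = h (i + 1) r c) ∨ (r + 1 < a ∧ h i (r + 1) c = h (i + 1) r c)
  F4 : ∀ i r c, r < a → c < b → h i r c < h (i + 1) r c → i + 1 < h i r c →
    (∃ c', c = c' + 1 ∧ h (i + 1) r c' = h i r c) ∨
    (∃ r', r = r' + 1 ∧ h (i + 1) r' c = h i r c)

namespace Growth_s2
variable {a b q : ℕ} {h : ℕ → ℕ → ℕ → ℕ}

theorem slide (G : Growth_s2 a b q h) {t0 i : ℕ} (hi : i < t0) :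
    Slide a b t0 (h i) (h (i + 1)) where
  Ar := G.F0r i
  Ac := G.F0c i
  Br := G.F0r (i + 1)
  Bc := G.F0c (i + 1)
  R1 := G.F2 i
  R2r := G.F2r i
  R2c := G.F2c i
  R4 := fun r c hr hc h1 h2 => G.F4 i r c hr hc h2 (by omega)

theorem L1 (G : Growth_s2 a b q h) {i n c : ℕ} (ha : 0 < a) (hc : c < b)
    (hj : i + n < h i (a - 1) c) : h (i + n) 0 (b - 1 - c) ≤ i + q := by
  obtain ⟨r', c', g1, g2, g3, g4, g5⟩ := slides (M := i + q) (t0 := i + n) (N := n) (b := b) ha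
    (A := fun k => h (i + k)) (fun k hk => G.slide (by omega))
    (fun c hc => G.F0r _ _ _ (by omega) hc) hc (by
      intro d hd hdb
      have : h i (a - 1) c ≤ h i (a - 1) d :=
        row_mono (f := h i (a - 1)) (fun c hc => G.F0r i _ _ (by omega) hc) hd hdb
      exact ⟨by simpa using hj.trans_le this, (G.F1 i _ d (by omega) hdb).2⟩)
  have e1 : h (i + n) 0 (b - 1 - c) ≤ h (i + n) 0 c' :=
    row_mono (f := h (i + n) 0) (fun c hc => G.F0r _ _ _ (by omega) hc) g1 g3
  have e2 : h (i + n) 0 c' ≤ h (i + n) r' c' :=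
    row_mono (f := fun r => h (i + n) r c') (fun r hr => G.F0c _ r c' hr g3) (Nat.zero_le _) g2
  exact e1.trans (e2.trans g5)

theorem ex_u (G : Growth_s2 a b q h) (J r c : ℕ) (hr : r < a) (hc : c < b) :
    ∃ u, ∀ i, i < u ↔ h i r c ≤ J := by
  have hex : ∃ i, J < h i r c := ⟨J, (G.F1 J r c hr hc).1⟩
  classical
  refine ⟨Nat.find hex, fun i => ?_⟩
  constructor
  · intro hi; exact not_lt.1 (Nat.find_min hex hi)
  · intro hi
    by_contra hcon
    have hm : ∀ k, Nat.find hex ≤ k → J < h k r c := by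
      intro k hk
      induction k, hk using Nat.le_induction with
      | base => exact Nat.find_spec hex
      | succ k hk ih => exact ih.trans_le (G.F2 k r c hr hc)
    have := hm i (by omega)
    omega

theorem L2 (G : Growth_s2 a b q h) {i n c : ℕ} (ha : 0 < a) (hc : c < b)
    (hnq : n ≤ q) (hi : q ≤ i)
    (hj : h i 0 c ≤ i + n) : i + q < h (i + n) (a - 1) (b - 1 - c) := by
  have hu : ∃ u : ℕ → ℕ → ℕ → ℕ, ∀ J r c, r < a → c < b → ∀ i, i < u J r c ↔ h i r c ≤ J := by
    have : ∀ J r c, ∃ u, r < a → c < b → ∀ i, i < u ↔ h i r c ≤ J := by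
      intro J r c
      by_cases hr : r < a
      · by_cases hc : c < b
        · obtain ⟨u, hu⟩ := G.ex_u J r c hr hc
          exact ⟨u, fun _ _ => hu⟩
        · exact ⟨0, fun _ h => absurd h hc⟩
      · exact ⟨0, fun h => absurd h hr⟩
    choose u hu using this
    exact ⟨u, hu⟩
  obtain ⟨u, hu⟩ := hu
  have ule : ∀ J r c, r < a → c < b → ∀ i, u J r c ≤ i ↔ J < h i r c := by
    intro J r c hr hc i
    have := hu J r c hr hc i
    omega
  -- facts on u
  have Upos : ∀ J r c, r < a → c < b → q ≤ J → 0 < u J r c := by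
    intro J r c hr hc hJ
    rw [hu J r c hr hc]
    have := (G.F1 0 r c hr hc).2
    omega
  have Ur : ∀ J r c, q ≤ J → r < a → c + 1 < b → u J r (c + 1) < u J r c := by
    intro J r c hJ hr hc
    obtain ⟨v, hv⟩ := Nat.exists_eq_succ_of_ne_zero (Upos J r (c + 1) hr hc hJ).ne'
    have h1 := (hu J r (c + 1) hr hc v).1 (by omega)
    have h2 := G.F2r v r c hr hc
    have h3 := (hu J r c hr (by omega) (v + 1)).2 (by omega)
    omega
  have Uc : ∀ J r c, q ≤ J → r + 1 < a → c < b → u J (r + 1) c < u J r c := by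
    intro J r c hJ hr hc
    obtain ⟨v, hv⟩ := Nat.exists_eq_succ_of_ne_zero (Upos J (r + 1) c hr hc hJ).ne'
    have h1 := (hu J (r + 1) c hr hc v).1 (by omega)
    have h2 := G.F2c v r c hr hc
    have h3 := (hu J r c (by omega) hc (v + 1)).2 (by omega)
    omega
  have U1 : ∀ J r c, r < a → c < b → u J r c ≤ u (J + 1) r c := by
    intro J r c hr hc
    rw [ule J r c hr hc]
    have := (ule (J + 1) r c hr hc (u (J + 1) r c)).1 le_rfl
    omega
  have U2r : ∀ J r c, r < a → c + 1 < b → u (J + 1) r (c + 1) ≤ u J r c := by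
    intro J r c hr hc
    rw [ule (J + 1) r (c + 1) hr hc]
    have := (ule J r c hr (by omega) (u J r c)).1 le_rfl
    have := G.F0r (u J r c) r c hr hc
    omega
  have U2c : ∀ J r c, r + 1 < a → c < b → u (J + 1) (r + 1) c ≤ u J r c := by
    intro J r c hr hc
    rw [ule (J + 1) (r + 1) c hr hc]
    have := (ule J r c (by omega) hc (u J r c)).1 le_rfl
    have := G.F0c (u J r c) r c hr hc
    omega
  have U4 : ∀ J r c, r < a → c < b → J + 1 ≤ i + q → i < u J r c → u J r c < u (J + 1) r c →
      (c + 1 < b ∧ u (J + 1) r (c + 1) = u J r c) ∨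
      (r + 1 < a ∧ u (J + 1) (r + 1) c = u J r c) := by
    intro J r c hr hc hJ h1 h2
    obtain ⟨v, hv⟩ : ∃ v, u J r c = v + 1 := ⟨u J r c - 1, by omega⟩
    have e1 := (hu J r c hr hc v).1 (by omega)
    have e2 := (ule J r c hr hc (v + 1)).1 (by omega)
    have e3 := (hu (J + 1) r c hr hc (v + 1)).1 (by omega)
    rcases G.F3 v r c hr hc (by omega) (by omega) with ⟨g1, g2⟩ | ⟨g1, g2⟩
    · left
      refine ⟨g1, ?_⟩
      have := U2r J r c hr g1
      have := (hu (J + 1) r (c + 1) hr g1 v).2 (by omega)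
      omega
    · right
      refine ⟨g1, ?_⟩
      have := U2c J r c g1 hc
      have := (hu (J + 1) (r + 1) c g1 hc v).2 (by omega)
      omega
  have e_r : ∀ r, r + 1 < a → a - 1 - r = a - 1 - (r + 1) + 1 := by intros; omega
  have e_c : ∀ c, c + 1 < b → b - 1 - c = b - 1 - (c + 1) + 1 := by intros; omega
  have S : ∀ k < q - n, Slide a b i (fun r c => u (i + n + k) (a - 1 - r) (b - 1 - c))
      (fun r c => u (i + n + (k + 1)) (a - 1 - r) (b - 1 - c)) := by
    intro k hk
    constructor
    · intro r c hr hc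
      simp only [e_c c hc]
      exact Ur _ _ _ (by omega) (by omega) (by omega)
    · intro r c hr hc
      simp only [e_r r hr]
      exact Uc _ _ _ (by omega) (by omega) (by omega)
    · intro r c hr hc
      simp only [e_c c hc]
      exact Ur _ _ _ (by omega) (by omega) (by omega)
    · intro r c hr hc
      simp only [e_r r hr]
      exact Uc _ _ _ (by omega) (by omega) (by omega)
    · intro r c hr hc
      exact U1 _ _ _ (by omega) (by omega)
    · intro r c hr hc
      simp only [e_c c hc]
      exact U2r _ _ _ (by omega) (by omega)
    · intro r c hr hc
      simp only [e_r r hr]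
      exact U2c _ _ _ (by omega) (by omega)
    · intro r c hr hc h1 h2
      rcases U4 _ _ _ (by omega) (by omega) (by omega) h1 h2 with ⟨g1, g2⟩ | ⟨g1, g2⟩
      · left
        refine ⟨c - 1, by omega, ?_⟩
        have : b - 1 - (c - 1) = b - 1 - c + 1 := by omega
        simp only [this]
        exact g2
      · right
        refine ⟨r - 1, by omega, ?_⟩
        have : a - 1 - (r - 1) = a - 1 - r + 1 := by omega
        simp only [this]
        exact g2
  obtain ⟨r', c', g1, g2, g3, g4, g5⟩ := slides (M := i + n) (t0 := i) (N := q - n) (b := b) ha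
    (A := fun k r c => u (i + n + k) (a - 1 - r) (b - 1 - c)) S
    (by
      intro c hc
      simp only [e_c c hc]
      exact Ur _ _ _ (by omega) (by omega) (by omega))
    (c := b - 1 - c) (by omega) (by
      intro d hd hdb
      simp only [Nat.sub_self, Nat.add_zero]
      rw [hu _ _ _ ha (by omega), ule _ _ _ ha (by omega)]
      constructor
      · have : h i 0 (b - 1 - d) ≤ h i 0 c :=
          row_mono (f := h i 0) (fun c hc => G.F0r i 0 c ha hc) (by omega) hc
        omega
      · have := (G.F1 (i + n) 0 (b - 1 - d) ha (by omega)).1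
        omega)
  have hN : i + n + (q - n) = i + q := by omega
  simp only [hN] at g4 g5
  rw [ule _ _ _ (by omega) (by omega)] at g5
  have e1 : h (i + n) (a - 1 - r') (b - 1 - c') ≤ h (i + n) (a - 1 - r') (b - 1 - c) :=
    row_mono (f := h (i + n) (a - 1 - r')) (fun c hc => G.F0r _ _ c (by omega) hc)
      (by omega) (by omega)
  have e2 : h (i + n) (a - 1 - r') (b - 1 - c) ≤ h (i + n) (a - 1) (b - 1 - c) :=
    row_mono (f := fun r => h (i + n) r (b - 1 - c)) (fun r hr => G.F0c _ r _ hr (by omega))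
      (by omega) (by omega)
  omega

theorem bottom (G : Growth_s2 a b q h) {i c : ℕ} (ha : 0 < a) (hc : c < b) (hi : q ≤ i) :
    h i (a - 1) c + q ≤ h (i + q) (a - 1) c := by
  have hb := G.F1 i (a - 1) c (by omega) hc
  obtain ⟨n, hn⟩ : ∃ n, h i (a - 1) c = i + n + 1 := ⟨h i (a - 1) c - i - 1, by omega⟩
  have h1 := G.L1 (i := i) (n := n) ha hc (by omega)
  have h2 := G.L2 (i := i + n) (n := q - n) (c := b - 1 - c) ha (by omega) (by omega) (by omega)
    (by have : i + n + (q - n) = i + q := by omega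
        rw [this]; exact h1)
  have e1 : i + n + (q - n) = i + q := by omega
  have e2 : b - 1 - (b - 1 - c) = c := by omega
  rw [e1, e2] at h2
  omega

/-- the bottom row cannot be constant -/
theorem final (G : Growth_s2 a b q h) (ha : 0 < a) (hb : 0 < b) (hq : a + b - 1 < q)
    (hconst : ∀ i c, c < b → h (i + 1) (a - 1) c = h i (a - 1) c + 1) : False := by
  -- bottom row
  have hrow : ∀ c, c < b → h 0 (a - 1) c = h 0 (a - 1) 0 + c := by
    intro c
    induction c with
    | zero => intro _; rfl
    | succ c ih =>
      intro hc
      have h1 := ih (by omega)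
      have h2 := hconst 0 c (by omega)
      have h3 := G.F0r 0 (a - 1) c (by omega) hc
      have h4 := G.F1 0 (a - 1) (c + 1) (by omega) hc
      rcases G.F3 0 (a - 1) c (by omega) (by omega) (by omega) (by omega) with g | g
      · omega
      · omega
  have hlast : q ≤ h 0 (a - 1) (b - 1) := by
    by_contra hcon
    have h2 := hconst 0 (b - 1) (by omega)
    rcases G.F3 0 (a - 1) (b - 1) (by omega) (by omega) (by omega) (by omega) with g | g
    · omega
    · omega
  have hl2 := hrow (b - 1) (by omega)
  have hc0 : ∀ i, h i (a - 1) 0 = h 0 (a - 1) 0 + i := by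
    intro i
    induction i with
    | zero => rfl
    | succ i ih => rw [hconst i 0 hb, ih]; omega
  have hcol : ∀ d, d < a → ∀ i, d ≤ i → h i (a - 1 - d) 0 + d = h 0 (a - 1) 0 + i := by
    intro d
    induction d with
    | zero => intro _ i _; exact hc0 i
    | succ d ih =>
      intro hd i hi
      obtain ⟨i, rfl⟩ : ∃ j, i = j + 1 := ⟨i - 1, by omega⟩
      have h1 := ih (by omega) i (by omega)
      have h2 := ih (by omega) (i + 1) (by omega)
      have e : a - 1 - d = a - 1 - (d + 1) + 1 := by omega
      have h3 := G.F0c i (a - 1 - (d + 1)) 0 (by omega) hb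
      have h4 := (G.F1 i (a - 1 - (d + 1)) 0 (by omega) hb).1
      rw [← e] at h3
      rcases G.F4 i (a - 1 - d) 0 (by omega) hb (by omega) (by omega) with ⟨c', g, _⟩ | ⟨r', g1, g2⟩
      · omega
      · have : r' = a - 1 - (d + 1) := by omega
        subst this
        omega
  have h1 := hcol (a - 1) (by omega) (a - 1) le_rfl
  have h2 := hcol (a - 1) (by omega) (a - 1 + 1) (by omega)
  rw [Nat.sub_self] at h1 h2
  have h3 := (G.F1 (a - 1) 0 0 ha hb).1
  by_cases h4 : a - 1 + 1 < h (a - 1) 0 0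
  · rcases G.F4 (a - 1) 0 0 ha hb (by omega) h4 with ⟨c', g, _⟩ | ⟨r', g1, g2⟩
    · omega
    · omega
  · omega
end Growth_s2

/-- extension of a filling to `ℕ × ℕ`, with value `q + 1` outside the rectangle -/
def ext {a b : ℕ} (q : ℕ) (T : Fin a × Fin b → ℕ) (r c : ℕ) : ℕ :=
  if h : r < a ∧ c < b then T (⟨r, h.1⟩, ⟨c, h.2⟩) else q + 1

theorem ext_in {a b q : ℕ} (T : Fin a × Fin b → ℕ) (x : Fin a × Fin b) :
    ext q T x.1 x.2 = T x := by
  simp [ext]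

theorem ext_out {a b q : ℕ} (T : Fin a × Fin b → ℕ) (r c : ℕ) (h : ¬ (r < a ∧ c < b)) :
    ext q T r c = q + 1 := by
  simp [ext, h]

structure Tab (a b q : ℕ) (A : ℕ → ℕ → ℕ) : Prop where
  out : ∀ r c, ¬ (r < a ∧ c < b) → A r c = q + 1
  pos : ∀ r c, r < a → c < b → 1 ≤ A r c
  le : ∀ r c, r < a → c < b → A r c ≤ q
  row : ∀ r c, r < a → c < b → A r c < A r (c + 1)
  col : ∀ r c, r < a → c < b → A r c < A (r + 1) c

theorem tab_of_inc {a b q : ℕ} {T : Fin a × Fin b → ℕ} (hT : IncTab a b q T) :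
    Tab a b q (ext q T) := by
  obtain ⟨h1, h2, h3⟩ := hT
  refine ⟨fun r c h => ext_out T r c h, ?_, ?_, ?_, ?_⟩
  · intro r c hr hc
    have := h1 (⟨r, hr⟩, ⟨c, hc⟩)
    simp [ext, hr, hc, this.1]
  · intro r c hr hc
    have := h1 (⟨r, hr⟩, ⟨c, hc⟩)
    simp [ext, hr, hc, this.2]
  · intro r c hr hc
    by_cases hc' : c + 1 < b
    · have := h2 ⟨r, hr⟩ ⟨c, hc⟩ ⟨c + 1, hc'⟩ (by simp)
      simpa [ext, hr, hc, hc'] using this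
    · rw [ext_out T r (c + 1) (by omega)]
      have := h1 (⟨r, hr⟩, ⟨c, hc⟩)
      simp only [ext, hr, hc, and_self, dite_true]
      omega
  · intro r c hr hc
    by_cases hc' : r + 1 < a
    · have := h3 ⟨r, hr⟩ ⟨r + 1, hc'⟩ ⟨c, hc⟩ (by simp)
      simpa [ext, hr, hc, hc'] using this
    · rw [ext_out T (r + 1) c (by omega)]
      have := h1 (⟨r, hr⟩, ⟨c, hc⟩)
      simp only [ext, hr, hc, and_self, dite_true]
      omega

theorem inc_of_tab {a b q : ℕ} {T : Fin a × Fin b → ℕ} (hA : Tab a b q (ext q T)) :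
    IncTab a b q T := by
  refine ⟨?_, ?_, ?_⟩
  · intro x
    rw [← ext_in (q := q) T x]
    exact ⟨hA.pos _ _ x.1.2 x.2.2, hA.le _ _ x.1.2 x.2.2⟩
  · intro i j k hjk
    have := row_smono (f := ext q T i) (b := b) (fun c hc => hA.row i c i.2 (by omega)) hjk k.2
    rwa [ext_in T (i, j), ext_in T (i, k)] at this
  · intro i j k hij
    have := row_smono (f := fun r => ext q T r k) (b := a)
      (fun r hr => hA.col r k (by omega) k.2) hij j.2
    rwa [ext_in T (i, k), ext_in T (j, k)] at this

/-- static description of promotion (before the final decrement) -/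
def hB (A : ℕ → ℕ → ℕ) : ℕ → ℕ → ℕ
  | 0, 0 => if A 0 0 = 1 then min (A 0 1) (A 1 0) else A 0 0
  | 0, c + 1 => if hB A 0 c = A 0 (c + 1) then min (A 0 (c + 2)) (A 1 (c + 1)) else A 0 (c + 1)
  | r + 1, 0 => if hB A r 0 = A (r + 1) 0 then min (A (r + 1) 1) (A (r + 2) 0) else A (r + 1) 0
  | r + 1, c + 1 => if hB A (r + 1) c = A (r + 1) (c + 1) ∨ hB A r (c + 1) = A (r + 1) (c + 1)
      then min (A (r + 1) (c + 2)) (A (r + 2) (c + 1)) else A (r + 1) (c + 1)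

def Hole (A : ℕ → ℕ → ℕ) (r c : ℕ) : Prop :=
  (r = 0 ∧ c = 0 ∧ A r c = 1) ∨ (∃ c', c = c' + 1 ∧ hB A r c' = A r c) ∨
    (∃ r', r = r' + 1 ∧ hB A r' c = A r c)

theorem hB_pos {A : ℕ → ℕ → ℕ} {r c : ℕ} (h : Hole A r c) :
    hB A r c = min (A r (c + 1)) (A (r + 1) c) := by
  rcases r with _ | r <;> rcases c with _ | c <;> simp [Hole] at h <;> rw [hB] <;> simp [h]

theorem hB_neg {A : ℕ → ℕ → ℕ} {r c : ℕ} (h : ¬ Hole A r c) :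
    hB A r c = A r c := by
  rcases r with _ | r <;> rcases c with _ | c <;> simp [Hole] at h <;> rw [hB] <;> simp [h]

section
variable {a b q : ℕ} {A : ℕ → ℕ → ℕ}

theorem hB_ge (hA : Tab a b q A) {r c : ℕ} (hr : r < a) (hc : c < b) : A r c ≤ hB A r c := by
  have h1 := hA.row r c hr hc
  have h2 := hA.col r c hr hc
  by_cases h : Hole A r c
  · rw [hB_pos h]; omega
  · rw [hB_neg h]

theorem hB_gt (hA : Tab a b q A) {r c : ℕ} (hr : r < a) (hc : c < b) (h : Hole A r c) :
    A r c < hB A r c := by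
  have h1 := hA.row r c hr hc
  have h2 := hA.col r c hr hc
  rw [hB_pos h]; omega

theorem hB_hole (_hA : Tab a b q A) {r c : ℕ} (h : A r c < hB A r c) : Hole A r c := by
  by_contra hcon
  rw [hB_neg hcon] at h
  omega

theorem hB_le (hA : Tab a b q A) {r c : ℕ} (hr : r < a) (hc : c < b) :
    hB A r c ≤ A r (c + 1) ∧ hB A r c ≤ A (r + 1) c := by
  have h1 := hA.row r c hr hc
  have h2 := hA.col r c hr hc
  by_cases h : Hole A r c
  · rw [hB_pos h]; omega
  · rw [hB_neg h]; omega

theorem hB_two (hA : Tab a b q A) {r c : ℕ} (hr : r < a) (hc : c < b) : 2 ≤ hB A r c := by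
  have h0 := hA.pos r c hr hc
  have h1 := hB_ge hA hr hc
  by_contra hcon
  have h2 : A r c = 1 := by omega
  rcases r with _ | r
  · rcases c with _ | c
    · have := hB_gt hA hr hc (Or.inl ⟨rfl, rfl, h2⟩)
      omega
    · have := hA.row 0 c hr (by omega)
      have := hA.pos 0 c hr (by omega)
      omega
  · have := hA.col r c (by omega) hc
    have := hA.pos r c (by omega) hc
    omega

theorem hB_row (hA : Tab a b q A) {r c : ℕ} (hr : r < a) (hc : c + 1 < b) :
    hB A r c < hB A r (c + 1) := by
  have h1 := (hB_le hA hr (by omega : c < b)).1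
  have h2 := hB_ge hA hr hc
  rcases h1.lt_or_eq with h | h
  · omega
  · have := hB_gt hA hr hc (Or.inr (Or.inl ⟨c, rfl, h⟩))
    omega

theorem hB_col (hA : Tab a b q A) {r c : ℕ} (hr : r + 1 < a) (hc : c < b) :
    hB A r c < hB A (r + 1) c := by
  have h1 := (hB_le hA (by omega : r < a) hc).2
  have h2 := hB_ge hA hr hc
  rcases h1.lt_or_eq with h | h
  · omega
  · have := hB_gt hA hr hc (Or.inr (Or.inr ⟨r, rfl, h⟩))
    omega

theorem tab_leq (hA : Tab a b q A) (r c : ℕ) : A r c ≤ q + 1 := by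
  by_cases h : r < a ∧ c < b
  · have := hA.le r c h.1 h.2; omega
  · rw [hA.out r c h]

theorem hB_leq (hA : Tab a b q A) {r c : ℕ} (hr : r < a) (hc : c < b) : hB A r c ≤ q + 1 :=
  (hB_le hA hr hc).1.trans (tab_leq hA _ _)
end

/-- filling after step `t` -/
def gAt (A : ℕ → ℕ → ℕ) (t r c : ℕ) : ℕ :=
  if t < A r c then A r c else if hB A r c ≤ t then hB A r c else 1

theorem ribbon_iff {a b t : ℕ} (f : Fin a × Fin b → ℕ) (x : Fin a × Fin b) :
    (∃ y, y ≠ x ∧ SameRibbon t f x y) ↔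
      ∃ u, Adj x u ∧ (f x = 1 ∨ f x = t) ∧ (f u = 1 ∨ f u = t) := by
  constructor
  · rintro ⟨y, hy, h⟩
    rcases Relation.ReflTransGen.cases_head h with h | ⟨u, hu, -⟩
    · exact absurd h.symm hy
    · exact ⟨u, hu⟩
  · rintro ⟨u, hu⟩
    refine ⟨u, ?_, Relation.ReflTransGen.single hu⟩
    rintro rfl
    rcases hu.1 with h | h <;> omega

theorem bk_eq {a b q t : ℕ} {T : Fin a × Fin b → ℕ} (hA : Tab a b q (ext q T)) (ht : 1 ≤ t)
    (htq : t + 1 ≤ q) (f : Fin a × Fin b → ℕ)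
    (hf : ∀ x : Fin a × Fin b, f x = gAt (ext q T) t x.1 x.2) (x : Fin a × Fin b) :
    BKstep (t + 1) f x = gAt (ext q T) (t + 1) x.1 x.2 := by
  obtain ⟨⟨r, hr⟩, ⟨c, hc⟩⟩ := x
  unfold BKstep
  simp only [ribbon_iff]
  have hx := hf (⟨r, hr⟩, ⟨c, hc⟩)
  simp only at hx ⊢
  set A := ext q T with hAdef
  have h2 := hB_two hA hr hc
  have hge := hB_ge hA hr hc
  have hle := hB_le hA hr hc
  have hrow := hA.row r c hr hc
  have hcol := hA.col r c hr hc
  -- west and north neighbours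
  have hW : ∀ c', c = c' + 1 → 2 ≤ hB A r c' ∧ hB A r c' ≤ A r c ∧ A r c' < A r c := by
    rintro c' rfl
    exact ⟨hB_two hA hr (by omega), (hB_le hA hr (by omega)).1, hA.row r c' hr (by omega)⟩
  have hN : ∀ r', r = r' + 1 → 2 ≤ hB A r' c ∧ hB A r' c ≤ A r c ∧ A r' c < A r c := by
    rintro r' rfl
    exact ⟨hB_two hA (by omega) hc, (hB_le hA (by omega) hc).2, hA.col r' c (by omega) hc⟩
  rcases lt_trichotomy (A r c) (t + 1) with hlt | heq | hgt
  · by_cases hBt : hB A r c ≤ t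
    · have : f (⟨r, hr⟩, ⟨c, hc⟩) = hB A r c := by
        rw [hx, gAt, if_neg (by omega), if_pos hBt]
      have hg : gAt A (t + 1) r c = hB A r c := by
        rw [gAt, if_neg (by omega), if_pos (by omega)]
      rw [this, hg]
      split_ifs <;> omega
    · have hf1 : f (⟨r, hr⟩, ⟨c, hc⟩) = 1 := by
        rw [hx, gAt, if_neg (by omega), if_neg hBt]
      have hH : Hole A r c := hB_hole hA (by omega)
      have hm := hB_pos hH
      by_cases hm1 : hB A r c = t + 1
      · rw [if_pos, hf1, if_pos rfl, gAt, if_neg (by omega), if_pos (by omega), hm1]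
        by_cases hE : A r (c + 1) = t + 1
        · have hcb : c + 1 < b := by
            by_contra hcon
            have := hA.out r (c + 1) (by omega)
            omega
          refine ⟨(⟨r, hr⟩, ⟨c + 1, hcb⟩), Or.inl ⟨rfl, Or.inl rfl⟩, Or.inl hf1, Or.inr ?_⟩
          rw [hf]
          simp only
          rw [gAt, if_pos (by omega), hE]
        · have hS : A (r + 1) c = t + 1 := by omega
          have hcb : r + 1 < a := by
            by_contra hcon
            have := hA.out (r + 1) c (by omega)
            omega
          refine ⟨(⟨r + 1, hcb⟩, ⟨c, hc⟩), Or.inr ⟨rfl, Or.inl rfl⟩, Or.inl hf1, Or.inr ?_⟩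
          rw [hf]
          simp only
          rw [gAt, if_pos (by omega), hS]
      · rw [if_neg, hf1, gAt, if_neg (by omega), if_neg (by omega)]
        rintro ⟨⟨⟨r', hr'⟩, ⟨c', hc'⟩⟩, hadj, -, hu⟩
        rw [hf] at hu
        simp only [Adj, Fin.mk.injEq] at hadj hu
        rcases hadj with ⟨rfl, h | h⟩ | ⟨rfl, h | h⟩
        · subst h
          rw [gAt, if_pos (by omega)] at hu
          omega
        · have := hW c' h.symm
          rw [gAt, if_neg (by omega), if_pos (by omega)] at hu
          omega
        · subst h
          rw [gAt, if_pos (by omega)] at hu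
          omega
        · have := hN r' h.symm
          rw [gAt, if_neg (by omega), if_pos (by omega)] at hu
          omega
  · have hf1 : f (⟨r, hr⟩, ⟨c, hc⟩) = t + 1 := by
      rw [hx, gAt, if_pos (by omega), heq]
    by_cases hH : Hole A r c
    · have hgt := hB_gt hA hr hc hH
      rw [if_pos, hf1, if_neg (by omega), if_pos rfl, gAt, if_neg (by omega), if_neg (by omega)]
      rcases hH with h | ⟨c', rfl, h⟩ | ⟨r', rfl, h⟩
      · omega
      · have := hW c' rfl
        refine ⟨(⟨r, hr⟩, ⟨c', by omega⟩), Or.inl ⟨rfl, Or.inr rfl⟩, Or.inr hf1, Or.inl ?_⟩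
        rw [hf]
        simp only
        rw [gAt, if_neg (by omega), if_neg (by omega)]
      · have := hN r' rfl
        refine ⟨(⟨r', by omega⟩, ⟨c, hc⟩), Or.inr ⟨rfl, Or.inr rfl⟩, Or.inr hf1, Or.inl ?_⟩
        rw [hf]
        simp only
        rw [gAt, if_neg (by omega), if_neg (by omega)]
    · have hBe := hB_neg hH
      rw [if_neg, hf1, gAt, if_neg (by omega), if_pos (by omega), hBe, heq]
      rintro ⟨⟨⟨r', hr'⟩, ⟨c', hc'⟩⟩, hadj, -, hu⟩
      rw [hf] at hu
      simp only [Adj, Fin.mk.injEq] at hadj hu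
      rcases hadj with ⟨rfl, h | h⟩ | ⟨rfl, h | h⟩
      · subst h
        rw [gAt, if_pos (by omega)] at hu
        omega
      · have := hW c' h.symm
        have hne : hB A r c' ≠ A r c := fun e => hH (Or.inr (Or.inl ⟨c', h.symm, e⟩))
        rw [gAt, if_neg (by omega), if_pos (by omega)] at hu
        omega
      · subst h
        rw [gAt, if_pos (by omega)] at hu
        omega
      · have := hN r' h.symm
        have hne : hB A r' c ≠ A r c := fun e => hH (Or.inr (Or.inr ⟨r', h.symm, e⟩))
        rw [gAt, if_neg (by omega), if_pos (by omega)] at hu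
        omega
  · have hf1 : f (⟨r, hr⟩, ⟨c, hc⟩) = A r c := by
      rw [hx, gAt, if_pos (by omega)]
    rw [hf1, gAt, if_pos hgt]
    split_ifs <;> omega

theorem sweep_eq {a b q : ℕ} {T : Fin a × Fin b → ℕ} (hA : Tab a b q (ext q T)) (t : ℕ)
    (htq : t + 1 ≤ q) (x : Fin a × Fin b) :
    sweepUpTo (t + 2) T x = gAt (ext q T) (t + 1) x.1 x.2 := by
  induction t generalizing x with
  | zero =>
    have h1 := hB_two hA x.1.2 x.2.2
    have h2 := hA.pos _ _ x.1.2 x.2.2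
    simp only [sweepUpTo, gAt]
    rw [if_neg (by omega : ¬ hB (ext q T) x.1 x.2 ≤ 0 + 1)]
    simp only [Nat.zero_add, Nat.sub_self, List.range'_zero, List.foldl_nil]
    rw [ext_in] at h2 ⊢
    split_ifs <;> omega
  | succ t ih =>
    have : sweepUpTo (t + 1 + 2) T = BKstep (t + 2) (sweepUpTo (t + 2) T) := by
      simp only [sweepUpTo, Nat.add_sub_cancel]
      rw [List.range'_concat, List.foldl_append]
      simp [Nat.add_comm]
    rw [this]
    exact bk_eq hA (by omega) (by omega) _ (fun x => ih (by omega) x) x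

theorem kpro_eq {a b q : ℕ} {T : Fin a × Fin b → ℕ} (hA : Tab a b q (ext q T)) (hq : 1 ≤ q)
    (x : Fin a × Fin b) : KPro q T x + 1 = hB (ext q T) x.1 x.2 := by
  obtain ⟨p, rfl⟩ : ∃ p, q = p + 1 := ⟨q - 1, by omega⟩
  have h := sweep_eq hA p (by omega) x
  have h1 := hB_two hA x.1.2 x.2.2
  have h2 := hB_leq hA x.1.2 x.2.2
  have h3 := hA.le _ _ x.1.2 x.2.2
  unfold KPro
  rw [gAt, if_neg (by omega)] at h
  rw [h]
  split_ifs <;> omega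

theorem ext_kpro {a b q : ℕ} {T : Fin a × Fin b → ℕ} (hA : Tab a b q (ext q T)) (hq : 1 ≤ q)
    {r c : ℕ} (hr : r < a) (hc : c < b) : ext q (KPro q T) r c + 1 = hB (ext q T) r c := by
  have := kpro_eq hA hq (⟨r, hr⟩, ⟨c, hc⟩)
  rw [← ext_in (q := q) (KPro q T)] at this
  exact this

theorem tab_kpro {a b q : ℕ} {T : Fin a × Fin b → ℕ} (hA : Tab a b q (ext q T)) (hq : 1 ≤ q) :
    Tab a b q (ext q (KPro q T)) := by
  have hle : ∀ r c, r < a → c < b → ext q (KPro q T) r c ≤ q := by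
    intro r c hr hc
    have := ext_kpro hA hq hr hc
    have := hB_leq hA hr hc
    omega
  refine ⟨fun r c h => ext_out _ r c h, ?_, hle, ?_, ?_⟩
  · intro r c hr hc
    have := ext_kpro hA hq hr hc
    have := hB_two hA hr hc
    omega
  · intro r c hr hc
    by_cases hc' : c + 1 < b
    · have := ext_kpro hA hq hr hc
      have := ext_kpro hA hq hr hc'
      have := hB_row hA hr hc'
      omega
    · rw [ext_out _ r (c + 1) (by omega)]
      have := hle r c hr hc
      omega
  · intro r c hr hc
    by_cases hc' : r + 1 < a
    · have := ext_kpro hA hq hr hc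
      have := ext_kpro hA hq hc' hc
      have := hB_col hA hc' hc
      omega
    · rw [ext_out _ (r + 1) c (by omega)]
      have := hle r c hr hc
      omega

theorem hB_eq_max {a b q : ℕ} {A : ℕ → ℕ → ℕ} (hA : Tab a b q A)
    {r c : ℕ} (hr : r < a) (hc : c < b) (h : A r c < hB A r c) :
    A r c = max 1 (max (if c = 0 then 0 else hB A r (c - 1)) (if r = 0 then 0 else hB A (r - 1) c)) := by
  have hH := hB_hole hA h
  have h0 := hA.pos r c hr hc
  have hW : (if c = 0 then 0 else hB A r (c - 1)) ≤ A r c := by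
    rcases c with _ | c
    · simp
    · simpa using (hB_le hA hr (by omega : c < b)).1
  have hN : (if r = 0 then 0 else hB A (r - 1) c) ≤ A r c := by
    rcases r with _ | r
    · simp
    · simpa using (hB_le hA (by omega : r < a) hc).2
  rcases hH with ⟨rfl, rfl, h⟩ | ⟨c', rfl, h⟩ | ⟨r', rfl, h⟩
  · simp [h]
  · simp only [Nat.add_one_ne_zero, if_false, Nat.add_sub_cancel] at hW hN ⊢
    omega
  · simp only [Nat.add_one_ne_zero, if_false, Nat.add_sub_cancel] at hW hN ⊢
    omega

theorem hB_inj_aux {a b q : ℕ} {A A' : ℕ → ℕ → ℕ} (hA : Tab a b q A) (hA' : Tab a b q A')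
    (h : ∀ r c, r < a → c < b → hB A r c = hB A' r c) (n : ℕ) :
    ∀ r c, r < a → c < b → a - r + (b - c) ≤ n → A r c < hB A r c → A' r c < hB A' r c := by
  induction n with
  | zero => intro r c hr hc hn; omega
  | succ n ih =>
    intro r c hr hc hn hlt
    by_contra hcon
    have e1 := hB_ge hA' hr hc
    have e2 := h r c hr hc
    have e3 := hB_pos (hB_hole hA hlt)
    have e4 := hA'.le r c hr hc
    have e5 := hA'.row r c hr hc
    have e6 := hA'.col r c hr hc
    by_cases hE : A r (c + 1) = hB A r c
    · have hcb : c + 1 < b := by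
        by_contra hcb
        have := hA.out r (c + 1) (by omega)
        omega
      have f1 := hB_row hA hr hcb
      have f2 := ih r (c + 1) hr hcb (by omega) (by omega)
      have g1 := hB_eq_max hA hr hcb (by omega)
      have g2 := hB_eq_max hA' hr hcb f2
      have : A r (c + 1) = A' r (c + 1) := by
        rw [g1, g2]
        simp only [Nat.add_one_ne_zero, if_false, Nat.add_sub_cancel]
        rw [h r c hr hc]
        rcases r with _ | r
        · simp
        · simp [h r (c + 1) (by omega) hcb]
      omega
    · have hS : A (r + 1) c = hB A r c := by omega
      have hcb : r + 1 < a := by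
        by_contra hcb
        have := hA.out (r + 1) c (by omega)
        omega
      have f1 := hB_col hA hcb hc
      have f2 := ih (r + 1) c hcb hc (by omega) (by omega)
      have g1 := hB_eq_max hA hcb hc (by omega)
      have g2 := hB_eq_max hA' hcb hc f2
      have : A (r + 1) c = A' (r + 1) c := by
        rw [g1, g2]
        simp only [Nat.add_one_ne_zero, if_false, Nat.add_sub_cancel]
        rw [h r c hr hc]
        rcases c with _ | c
        · simp
        · simp [h (r + 1) c hcb (by omega)]
      omega

theorem hB_inj {a b q : ℕ} {A A' : ℕ → ℕ → ℕ} (hA : Tab a b q A) (hA' : Tab a b q A')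
    (h : ∀ r c, r < a → c < b → hB A r c = hB A' r c) (r c : ℕ) (hr : r < a) (hc : c < b) :
    A r c = A' r c := by
  have h1 := hB_inj_aux hA hA' h _ r c hr hc le_rfl
  have h2 := hB_inj_aux hA' hA (fun r c hr hc => (h r c hr hc).symm) _ r c hr hc le_rfl
  have e1 := hB_ge hA hr hc
  have e2 := hB_ge hA' hr hc
  have e3 := h r c hr hc
  by_cases hlt : A r c < hB A r c
  · rw [hB_eq_max hA hr hc hlt, hB_eq_max hA' hr hc (h1 hlt)]
    rcases r with _ | r <;> rcases c with _ | c
    · simp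
    · simp [h 0 c hr (by omega)]
    · simp [h r 0 (by omega) hc]
    · simp [h (r + 1) c hr (by omega), h r (c + 1) (by omega) hc]
  · by_cases hlt' : A' r c < hB A' r c
    · exact absurd (h2 hlt') hlt
    · omega

theorem kpro_inj {a b q : ℕ} (hq : 1 ≤ q) {T T' : Fin a × Fin b → ℕ} (hT : IncTab a b q T)
    (hT' : IncTab a b q T') (h : KPro q T = KPro q T') : T = T' := by
  have hA := tab_of_inc hT
  have hA' := tab_of_inc hT'
  funext x
  rw [← ext_in (q := q) T x, ← ext_in (q := q) T' x]
  refine hB_inj hA hA' ?_ _ _ x.1.2 x.2.2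
  intro r c hr hc
  rw [← ext_kpro hA hq hr hc, ← ext_kpro hA' hq hr hc, h]

theorem inc_iter {a b q : ℕ} (hq : 1 ≤ q) {T : Fin a × Fin b → ℕ} (hT : IncTab a b q T) (n : ℕ) :
    IncTab a b q ((KPro q)^[n] T) := by
  induction n with
  | zero => exact hT
  | succ n ih =>
    rw [Function.iterate_succ_apply']
    exact inc_of_tab (tab_kpro (tab_of_inc ih) hq)

theorem growth {a b q : ℕ} (hq : 1 ≤ q) {T : Fin a × Fin b → ℕ} (hT : IncTab a b q T) :
    Growth_s2 a b q (fun i r c => ext q ((KPro q)^[i] T) r c + i) := by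
  have hA : ∀ i, Tab a b q (ext q ((KPro q)^[i] T)) := fun i => tab_of_inc (inc_iter hq hT i)
  have hs : ∀ i r c, r < a → c < b → ext q ((KPro q)^[i + 1] T) r c + (i + 1) =
      hB (ext q ((KPro q)^[i] T)) r c + i := by
    intro i r c hr hc
    rw [Function.iterate_succ_apply', ← ext_kpro (hA i) hq hr hc]
    omega
  constructor
  · intro i r c hr hc
    have := (hA i).row r c hr (by omega)
    omega
  · intro i r c hr hc
    have := (hA i).col r c (by omega) hc
    omega
  · intro i r c hr hc
    have := (hA i).pos r c hr hc
    have := (hA i).le r c hr hc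
    omega
  · intro i r c hr hc
    simp only [hs i r c hr hc]
    have := hB_ge (hA i) hr hc
    omega
  · intro i r c hr hc
    simp only [hs i r c hr (by omega)]
    have := hB_le (hA i) hr (by omega : c < b)
    omega
  · intro i r c hr hc
    simp only [hs i r c (by omega) hc]
    have := hB_le (hA i) (by omega : r < a) hc
    omega
  · intro i r c hr hc
    simp only [hs i r c hr hc]
    intro h1 h2
    have h3 := hB_pos (hB_hole (hA i) (by omega : _ < hB _ r c))
    by_cases hE : ext q ((KPro q)^[i] T) r (c + 1) = hB (ext q ((KPro q)^[i] T)) r c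
    · left
      refine ⟨?_, by omega⟩
      by_contra hcon
      have := (hA i).out r (c + 1) (by omega)
      omega
    · right
      refine ⟨?_, by omega⟩
      by_contra hcon
      have := (hA i).out (r + 1) c (by omega)
      omega
  · intro i r c hr hc
    simp only [hs i r c hr hc]
    intro h1 h2
    rcases hB_hole (hA i) (by omega : _ < hB _ r c) with h | ⟨c', rfl, h⟩ | ⟨r', rfl, h⟩
    · omega
    · left
      refine ⟨c', rfl, ?_⟩
      rw [hs i r c' hr (by omega), h]
    · right
      refine ⟨r', rfl, ?_⟩
      rw [hs i r' c (by omega) hc, h]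

/-- **Theorem 2.4.** Let `q > a + b - 1` and suppose the K-promotion orbit of
`T ∈ Inc^q(a × b)` has cardinality `k`. Then `gcd(k, q) > 1`. -/
theorem kpromotion_orbit_gcd (a b : ℕ) (ha : 0 < a) (hb : 0 < b) (q k : ℕ)
    (hq : a + b - 1 < q) (T : Fin a × Fin b → ℕ) (hT : IncTab a b q T)
    (hk : (PsiOrbit q T).ncard = k) :
    1 < Nat.gcd k q := by
  have hq1 : 1 ≤ q := by omega
  have hinc := inc_iter hq1 hT
  -- finiteness and periodicity
  have hfin : (PsiOrbit q T).Finite := by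
    refine Set.Finite.subset (Set.Finite.pi' (fun _ : Fin a × Fin b => Set.finite_Iic q)) ?_
    rintro U ⟨n, rfl⟩ x
    exact ((hinc n).1 x).2
  have hper : ∃ p, 0 < p ∧ (KPro q)^[p] T = T := by
    have hni : ¬ Function.Injective (fun n => (KPro q)^[n] T) := by
      intro hinj
      exact Set.infinite_range_of_injective hinj hfin
    rw [Function.not_injective_iff] at hni
    obtain ⟨m, n, hmn, hne⟩ := hni
    have peel : ∀ m d, (KPro q)^[m + d] T = (KPro q)^[m] T → (KPro q)^[d] T = T := by
      intro m d
      induction m with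
      | zero => intro h; simpa using h
      | succ m ih =>
        intro h
        apply ih
        have e : m + 1 + d = m + d + 1 := by omega
        rw [e, Function.iterate_succ_apply', Function.iterate_succ_apply'] at h
        exact kpro_inj hq1 (hinc _) (hinc _) h
    rcases lt_or_gt_of_ne hne with h | h
    · exact ⟨n - m, by omega, peel m (n - m) (by rw [Nat.add_sub_cancel' h.le]; exact hmn.symm)⟩
    · exact ⟨m - n, by omega, peel n (m - n) (by rw [Nat.add_sub_cancel' h.le]; exact hmn)⟩
  obtain ⟨p, hp, hpT⟩ := hper
  have hpp : T ∈ Function.periodicPts (KPro (a := a) (b := b) q) := ⟨p, hp, hpT⟩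
  have hmin := Function.minimalPeriod_pos_of_mem_periodicPts hpp
  have horb : PsiOrbit q T = (fun n => (KPro q)^[n] T) ''
      (Set.Iio (Function.minimalPeriod (KPro q) T)) := by
    ext U
    constructor
    · rintro ⟨n, rfl⟩
      exact ⟨n % _, Nat.mod_lt _ hmin, Function.iterate_mod_minimalPeriod_eq⟩
    · rintro ⟨n, -, rfl⟩
      exact ⟨n, rfl⟩
  have hkm : k = Function.minimalPeriod (KPro q) T := by
    rw [← hk, horb, Set.InjOn.ncard_image Function.iterate_injOn_Iio_minimalPeriod]
    simp [Set.ncard_eq_toFinset_card']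
  have hk0 : 0 < k := by omega
  have hkT : (KPro q)^[k] T = T := by
    rw [hkm]; exact Function.iterate_minimalPeriod
  by_contra hcon
  have hg : Nat.gcd k q = 1 := by
    have := Nat.gcd_pos_of_pos_left q hk0
    omega
  have hG := growth hq1 hT
  set β : ℕ → ℕ → ℕ := fun n c => ext q ((KPro q)^[n] T) (a - 1) c with hβ
  have hβk : ∀ u n c, β (n + u * k) c = β n c := by
    intro u n c
    have : (KPro q)^[u * k] T = T := by
      have h1 : Function.IsPeriodicPt (KPro q) k T := hkT
      exact h1.const_mul u
    simp only [hβ, Function.iterate_add_apply, this]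
  have hβq : ∀ n c, c < b → β n c ≤ β (n + q) c := by
    intro n c hc
    have h1 := hG.bottom (i := n + q * k) ha hc
      (by have := Nat.le_mul_of_pos_right q hk0; omega)
    have h2 := hβk q n c
    have h3 := hβk q (n + q) c
    have e : n + q + q * k = n + q * k + q := by omega
    rw [e] at h3
    simp only [hβ] at h1 h2 h3 ⊢
    omega
  have hβm : ∀ u n c, c < b → β n c ≤ β (n + u * q) c := by
    intro u n c hc
    induction u with
    | zero => simp
    | succ u ih =>
      have e : n + (u + 1) * q = n + u * q + q := by ring
      rw [e]
      exact ih.trans (hβq _ c hc)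
  have hβe : ∀ u n c, c < b → β (n + u * q) c = β n c := by
    intro u n c hc
    refine le_antisymm ?_ (hβm u n c hc)
    have h1 := hβm (u * (k - 1)) (n + u * q) c hc
    have e : n + u * q + u * (k - 1) * q = n + (u * q) * k := by
      obtain ⟨k', rfl⟩ : ∃ k', k = k' + 1 := ⟨k - 1, by omega⟩
      simp only [Nat.add_sub_cancel]
      ring
    rw [e, hβk] at h1
    exact h1
  obtain ⟨u, v, huv⟩ : ∃ u v, u * k = v * q + 1 := by
    obtain ⟨m, hm⟩ := Nat.exists_mul_mod_eq_one_of_coprime (k := q) (n := k) hg (by omega)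
    refine ⟨m, k * m / q, ?_⟩
    have := Nat.div_add_mod (k * m) q
    rw [hm.2, mul_comm q] at this
    rw [this, mul_comm]
  have hβ1 : ∀ n c, c < b → β (n + 1) c = β n c := by
    intro n c hc
    rw [← hβe v (n + 1) c hc, ← hβk u n c]
    congr 1
    omega
  refine hG.final ha hb hq ?_
  intro i c hc
  have := hβ1 i c hc
  simp only [hβ] at this ⊢
  omega
end
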